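/- Let 1 < p < 2, p ≤ q, assume (p−1)²(q−1) > 1, set κ₁ = p−1, κ₂ = q(p−1)−1, and let a_j and ℓ be as in the context. Suppose u₂, u₂* ∈ X²(κ₂) satisfy u₂ − u₂* ∈ Z²(a_{ℓ+1}) and ‖u₂‖_{X²(κ₂)} + ‖u₂*‖_{X²(κ₂)} ≤ C ε with 0 < ε ≤ 1. Then, with G(v,v*) = |∂_t v|^p − |∂_t v*|^p, ‖R(G(u₂,u₂*))‖_{Z¹(κ₁a_{ℓ+1})} ≤ C′ ε^{p−1} ‖u₂ − u₂*‖_{Z¹(a_{ℓ+1})} and ‖R(G(u₂,u₂*))‖_{Z²(κ₁a_{ℓ+1})} ≤ C′ ε^{p−1} (‖u₂ − u₂*‖_{Z²(a_{ℓ+1})} + ‖u₂ − u₂*‖_{Z¹(a_{ℓ+1})}^{p−1}), where C′ depends only on p, q and C. -/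

import Mathlib

open Real MeasureTheory Filter

noncomputable section

/-- Partial derivative with respect to the first (radial) variable. -/
def pdr (u : ℝ → ℝ → ℝ) : ℝ → ℝ → ℝ := fun r t => deriv (fun r' => u r' t) r

/-- Partial derivative with respect to the second (time) variable. -/
def pdt (u : ℝ → ℝ → ℝ) : ℝ → ℝ → ℝ := fun r t => deriv (fun t' => u r t') t

/-- `[u(r,t)]₁ = |u| + r (|∂_r u| + |∂_t u|)`. -/
def bracket1 (u : ℝ → ℝ → ℝ) (r t : ℝ) : ℝ :=
  |u r t| + r * (|pdr u r t| + |pdt u r t|)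

/-- `[u(r,t)]₂ = |u| + (1+r)(|∂_r u| + |∂_t u|) + r (|∂_r² u| + |∂_r∂_t u| + |∂_t² u|)`. -/
def bracket2 (u : ℝ → ℝ → ℝ) (r t : ℝ) : ℝ :=
  |u r t| + (1 + r) * (|pdr u r t| + |pdt u r t|) +
    r * (|pdr (pdr u) r t| + |pdr (pdt u) r t| + |pdt (pdt u) r t|)

def bracketS (s : ℕ) (u : ℝ → ℝ → ℝ) (r t : ℝ) : ℝ :=
  if s = 1 then bracket1 u r t else bracket2 u r t

/-- Membership in the class `X^s`: `u ∈ C^{s-1}(ℝ × [0,∞))`, `r u ∈ C^s(ℝ × [0,∞))`,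
and `u` is even in `r`. -/
def memX (s : ℕ) (u : ℝ → ℝ → ℝ) : Prop :=
  ContDiffOn ℝ ((s - 1 : ℕ) : ℕ∞) (fun z : ℝ × ℝ => u z.1 z.2) (Set.univ ×ˢ Set.Ici (0:ℝ)) ∧
  ContDiffOn ℝ ((s : ℕ) : ℕ∞) (fun z : ℝ × ℝ => z.1 * u z.1 z.2) (Set.univ ×ˢ Set.Ici (0:ℝ)) ∧
  ∀ r t : ℝ, 0 ≤ t → u (-r) t = u r t

/-- The set of values whose supremum is `‖u‖_{X^s(ν)}`. -/
def XSet (s : ℕ) (ν : ℝ) (u : ℝ → ℝ → ℝ) : Set ℝ :=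
  {x | ∃ r t : ℝ, 0 < r ∧ 0 ≤ t ∧ x = bracketS s u r t * (1 + |r - t|) ^ ν}

/-- `‖u‖_{X^s(ν)}`. -/
def Xnorm (s : ℕ) (ν : ℝ) (u : ℝ → ℝ → ℝ) : ℝ := sSup (XSet s ν u)

/-- `u ∈ X^s(ν)`. -/
def memXnu (s : ℕ) (ν : ℝ) (u : ℝ → ℝ → ℝ) : Prop := memX s u ∧ BddAbove (XSet s ν u)

/-- The set of values whose supremum is `‖u‖_{Z^s(ν)}`. -/
def ZSet (s : ℕ) (ν : ℝ) (u : ℝ → ℝ → ℝ) : Set ℝ :=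
  {x | ∃ r t : ℝ, 0 < r ∧ 0 ≤ t ∧
    x = bracketS s u r t * (1 + r + t) ^ (ν - 1) * (1 + |r - t|)}

/-- `‖u‖_{Z^s(ν)}`. -/
def Znorm (s : ℕ) (ν : ℝ) (u : ℝ → ℝ → ℝ) : ℝ := sSup (ZSet s ν u)

/-- `u ∈ Z^s(ν)`. -/
def memZnu (s : ℕ) (ν : ℝ) (u : ℝ → ℝ → ℝ) : Prop := memX s u ∧ BddAbove (ZSet s ν u)

/-- `|||f⃗(r)|||`. -/
def tripleNorm (f g : ℝ → ℝ) (r : ℝ) : ℝ :=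
  |f r| + (1 + r) * (|deriv f r| + |g r|) + r * (|deriv (deriv f) r| + |deriv g r|)

def tnorm (fg : (ℝ → ℝ) × (ℝ → ℝ)) (r : ℝ) : ℝ := tripleNorm fg.1 fg.2 r

/-- `f⃗ ∈ Y_ν(ε)`. -/
def memY (ν ε : ℝ) (fg : (ℝ → ℝ) × (ℝ → ℝ)) : Prop :=
  ContDiff ℝ 1 fg.1 ∧ Continuous fg.2 ∧
  (∀ r : ℝ, fg.1 (-r) = fg.1 r) ∧ (∀ r : ℝ, fg.2 (-r) = fg.2 r) ∧
  ContDiff ℝ 2 (fun r : ℝ => r * fg.1 r) ∧ ContDiff ℝ 1 (fun r : ℝ => r * fg.2 r) ∧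
  ∀ r : ℝ, 0 < r → (1 + r) ^ ν * tnorm fg r ≤ ε

/-- Solution operator `K[f⃗]` of the radial homogeneous wave equation. -/
def Kop (fg : (ℝ → ℝ) × (ℝ → ℝ)) : ℝ → ℝ → ℝ := fun r t =>
  (1 / (2 * r)) * ((∫ l in (r - t)..(r + t), l * fg.2 l) +
    deriv (fun s : ℝ => ∫ l in (r - s)..(r + s), l * fg.1 l) t)

/-- Duhamel operator `L(F)` for the initial value problem with zero data. -/
def Lop (F : ℝ → ℝ → ℝ) : ℝ → ℝ → ℝ := fun r t =>
  (1 / (2 * r)) * ∫ s in (0:ℝ)..t, (∫ l in (r - (t - s))..(r + (t - s)), l * F l s)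

/-- Operator `R(F)` associated with the final value problem. -/
def Rop (F : ℝ → ℝ → ℝ) : ℝ → ℝ → ℝ := fun r t =>
  (1 / (2 * r)) * ∫ s in Set.Ioi t, (∫ l in ((s - t) - r)..((s - t) + r), l * F l s)

/-- Values whose supremum is `M₀(F)`. -/
def M0Set (α β γ δ : ℝ) (F : ℝ → ℝ → ℝ) : Set ℝ :=
  {x | ∃ r t : ℝ, 0 < r ∧ 0 ≤ t ∧
    x = |F r t| * r ^ α * (1 + r) ^ β * (1 + r + t) ^ γ * (1 + |r - t|) ^ δ}

/-- Values whose supremum is the second summand of `M₁(F)`. -/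
def M1Set (α β γ δ : ℝ) (F : ℝ → ℝ → ℝ) : Set ℝ :=
  {x | ∃ r t : ℝ, 0 < r ∧ 0 ≤ t ∧
    x = |pdr F r t| * r ^ (α + 1) * (1 + r) ^ (β - 1) * (1 + r + t) ^ γ * (1 + |r - t|) ^ δ}

/-- `M_s(F)` for `s = 0, 1`. -/
def Mnorm (s : ℕ) (α β γ δ : ℝ) (F : ℝ → ℝ → ℝ) : ℝ :=
  if s = 0 then sSup (M0Set α β γ δ F)
  else sSup (M0Set α β γ δ F) + sSup (M1Set α β γ δ F)

/-- Finiteness of `M_s(F)`. -/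
def MFinite (s : ℕ) (α β γ δ : ℝ) (F : ℝ → ℝ → ℝ) : Prop :=
  BddAbove (M0Set α β γ δ F) ∧ (s = 0 ∨ BddAbove (M1Set α β γ δ F))

/-- Energy norm `‖w(t)‖_E` of the radial function `w(|x|,t)` on `ℝ³`. -/
def energy (w : ℝ → ℝ → ℝ) (t : ℝ) : ℝ :=
  Real.sqrt ((1 / 2) * ∫ x : EuclideanSpace ℝ (Fin 3),
    ((pdt w ‖x‖ t) ^ 2 + (pdr w ‖x‖ t) ^ 2))

/-- The nonlinearity `|∂_t u|^p`. -/
def NLt (p : ℝ) (u : ℝ → ℝ → ℝ) : ℝ → ℝ → ℝ := fun r t => |pdt u r t| ^ p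

/-- `(u₁,u₂)` solves the radially symmetric system (S). -/
def solvesS (p q : ℝ) (u₁ u₂ : ℝ → ℝ → ℝ) : Prop :=
  ∀ r t : ℝ, 0 < r → 0 ≤ t →
    pdt (pdt u₁) r t - (pdr (pdr u₁) r t + (2 / r) * pdr u₁ r t) = |pdt u₂ r t| ^ p ∧
    pdt (pdt u₂) r t - (pdr (pdr u₂) r t + (2 / r) * pdr u₂ r t) = |pdt u₁ r t| ^ q

/-- Initial data `(u(·,0), ∂_t u(·,0))` of a function `u(r,t)`. -/
def datum (u : ℝ → ℝ → ℝ) : (ℝ → ℝ) × (ℝ → ℝ) := (fun r => u r 0, fun r => pdt u r 0)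

/-- The sequence `a₀ = 1`, `a_{j+1} = κ₁ (a_j - 1) + κ₂`. -/
def aseq (κ₁ κ₂ : ℝ) : ℕ → ℝ
  | 0 => 1
  | n + 1 => κ₁ * (aseq κ₁ κ₂ n - 1) + κ₂

/-- Auxiliary iteration producing the pairs `((w_j, v_j), (w_{j+1}, v_{j+1}))`. -/
def iterAux (p q : ℝ) (fg1 fg2 : (ℝ → ℝ) × (ℝ → ℝ)) :
    ℕ → ((ℝ → ℝ → ℝ) × (ℝ → ℝ → ℝ)) × ((ℝ → ℝ → ℝ) × (ℝ → ℝ → ℝ))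
  | 0 =>
    ((Kop fg1, Kop fg2),
     (Kop fg1 + Lop (NLt p (Kop fg2)),
      Kop fg2 + Rop (NLt q (Kop fg1 + Lop (NLt p (Kop fg2))))))
  | n + 1 =>
    let prev := iterAux p q fg1 fg2 n
    let wnext := prev.2.1 + Lop (NLt p prev.2.2 - NLt p prev.1.2)
    (prev.2, (wnext, prev.2.2 + Rop (NLt q wnext - NLt q prev.2.1)))

/-- The iterate `w_j`. -/
def witer (p q : ℝ) (fg1 fg2 : (ℝ → ℝ) × (ℝ → ℝ)) (j : ℕ) : ℝ → ℝ → ℝ :=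
  (iterAux p q fg1 fg2 j).1.1

/-- The iterate `v_j`. -/
def viter (p q : ℝ) (fg1 fg2 : (ℝ → ℝ) × (ℝ → ℝ)) (j : ℕ) : ℝ → ℝ → ℝ :=
  (iterAux p q fg1 fg2 j).1.2

/-- The starred iterates `(w_j^*, v_j^*)` built from a solution `(u₁,u₂)`. -/
def starIter (p q : ℝ) (φ1 : (ℝ → ℝ) × (ℝ → ℝ)) (u₁ u₂ : ℝ → ℝ → ℝ) :
    ℕ → (ℝ → ℝ → ℝ) × (ℝ → ℝ → ℝ)
  | 0 => (Kop φ1, u₂ - Rop (NLt q u₁))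
  | n + 1 =>
    let w := Kop φ1 + Lop (NLt p (starIter p q φ1 u₁ u₂ n).2)
    (w, (u₂ - Rop (NLt q u₁)) + Rop (NLt q w))

/-- The quantity `d₁(w, 0) = ‖w‖_{Z²(κ₁ a_{ℓ+1})} + ‖w‖_{Z¹(κ₁ a_{ℓ+1})}^{p-1}` (applied to
differences). -/
def dOne (p q : ℝ) (ℓ : ℕ) (w : ℝ → ℝ → ℝ) : ℝ :=
  Znorm 2 ((p - 1) * aseq (p - 1) (q * (p - 1) - 1) (ℓ + 1)) w +
    Znorm 1 ((p - 1) * aseq (p - 1) (q * (p - 1) - 1) (ℓ + 1)) w ^ (p - 1)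

/-- The quantity `d₂(w, 0) = ‖w‖_{Z²(a_{ℓ+1})} + ‖w‖_{Z¹(a_{ℓ+1})}^{p-1}` (applied to
differences). -/
def dTwo (p q : ℝ) (ℓ : ℕ) (w : ℝ → ℝ → ℝ) : ℝ :=
  Znorm 2 (aseq (p - 1) (q * (p - 1) - 1) (ℓ + 1)) w +
    Znorm 1 (aseq (p - 1) (q * (p - 1) - 1) (ℓ + 1)) w ^ (p - 1)

/-- Membership in the metric ball `D_ε` around `(w_{ℓ+1}, v_{ℓ+1})`. -/
def memD (p q ε : ℝ) (ℓ : ℕ) (fg1 fg2 : (ℝ → ℝ) × (ℝ → ℝ)) (u₁ u₂ : ℝ → ℝ → ℝ) : Prop :=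
  memX 2 u₁ ∧ memX 2 u₂ ∧
  BddAbove (ZSet 2 ((p - 1) * aseq (p - 1) (q * (p - 1) - 1) (ℓ + 1))
    (u₁ - witer p q fg1 fg2 (ℓ + 1))) ∧
  BddAbove (ZSet 1 ((p - 1) * aseq (p - 1) (q * (p - 1) - 1) (ℓ + 1))
    (u₁ - witer p q fg1 fg2 (ℓ + 1))) ∧
  BddAbove (ZSet 2 (aseq (p - 1) (q * (p - 1) - 1) (ℓ + 1))
    (u₂ - viter p q fg1 fg2 (ℓ + 1))) ∧
  BddAbove (ZSet 1 (aseq (p - 1) (q * (p - 1) - 1) (ℓ + 1))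
    (u₂ - viter p q fg1 fg2 (ℓ + 1))) ∧
  dOne p q ℓ (u₁ - witer p q fg1 fg2 (ℓ + 1)) + dTwo p q ℓ (u₂ - viter p q fg1 fg2 (ℓ + 1))
    ≤ ε ^ ((p - 1) * (q + (ℓ : ℝ) * (p + q - 2)))

lemma integrableOn_Ioi_change {f : ℝ → ℝ} (hf : Continuous f) {a b : ℝ}
    (h : IntegrableOn f (Set.Ioi a)) : IntegrableOn f (Set.Ioi b) := by
  have h1 : IntegrableOn f (Set.Icc (min a b) (max a b)) := hf.integrableOn_Icc
  refine (h1.union h).mono_set ?_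
  intro x hx
  by_cases hxa : a < x
  · right; exact hxa
  · left
    push Not at hxa
    exact ⟨(min_le_right _ _).trans (le_of_lt hx), hxa.trans (le_max_left _ _)⟩

lemma leibniz (G G' : ℝ → ℝ → ℝ) (m : ℝ → ℝ) (m' τ₀ : ℝ) (bound : ℝ → ℝ)
    (hm : HasDerivAt m m' τ₀)
    (hGc : Continuous (Function.uncurry G))
    (hG'c : Continuous (Function.uncurry G'))
    (hintg : ∀ τ ∈ Metric.ball τ₀ 1, IntegrableOn (G τ) (Set.Ioi (m τ₀)))
    (hd : ∀ τ s, HasDerivAt (fun τ => G τ s) (G' τ s) τ)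
    (hb : ∀ τ ∈ Metric.ball τ₀ 1, ∀ s, m τ₀ < s → |G' τ s| ≤ bound s)
    (hbi : IntegrableOn bound (Set.Ioi (m τ₀))) :
    HasDerivAt (fun τ => ∫ s in Set.Ioi (m τ), G τ s)
      ((∫ s in Set.Ioi (m τ₀), G' τ₀ s) - m' * G τ₀ (m τ₀)) τ₀ := by
  have hcs : ∀ τ, Continuous (G τ) := fun τ => hGc.comp (by fun_prop : Continuous fun s => (τ, s))
  have hcs' : ∀ τ, Continuous (G' τ) := fun τ => hG'c.comp (by fun_prop : Continuous fun s => (τ, s))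
  have hball : Metric.ball τ₀ (1:ℝ) ∈ nhds τ₀ := Metric.ball_mem_nhds _ one_pos
  have h1 : HasDerivAt (fun τ => ∫ s in Set.Ioi (m τ₀), G τ s)
      (∫ s in Set.Ioi (m τ₀), G' τ₀ s) τ₀ := by
    refine (hasDerivAt_integral_of_dominated_loc_of_deriv_le (bound := bound) hball ?_ ?_ ?_ ?_ hbi ?_).2
    · exact Eventually.of_forall fun τ => (hcs τ).aestronglyMeasurable
    · exact hintg τ₀ (Metric.mem_ball_self one_pos)
    · exact (hcs' τ₀).aestronglyMeasurable
    · refine (ae_restrict_mem measurableSet_Ioi).mono fun s hs τ hτ => ?_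
      exact hb τ hτ s hs
    · exact Eventually.of_forall fun s τ _ => hd τ s
  have h2 : HasDerivAt (fun τ => ∫ s in (m τ₀)..(m τ), G τ s) (m' * G τ₀ (m τ₀)) τ₀ := by
    have h3 : HasDerivAt (fun τ => (m τ - m τ₀) * G τ₀ (m τ₀)) (m' * G τ₀ (m τ₀)) τ₀ :=
      (hm.sub_const _).mul_const _
    have h4 : HasDerivAt (fun τ => ∫ s in (m τ₀)..(m τ), (G τ s - G τ₀ (m τ₀))) 0 τ₀ := by
      rw [hasDerivAt_iff_isLittleO]
      simp only [intervalIntegral.integral_same, sub_zero, smul_zero]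
      have hO : (fun τ => m τ - m τ₀) =O[nhds τ₀] fun τ => τ - τ₀ := hm.isBigO_sub
      refine Asymptotics.IsLittleO.trans_isBigO ?_ hO
      rw [Asymptotics.isLittleO_iff]
      intro c hc
      have hcont : Tendsto (fun z : ℝ × ℝ => G z.1 z.2) (nhds (τ₀, m τ₀)) (nhds (G τ₀ (m τ₀))) :=
        hGc.tendsto (τ₀, m τ₀)
      have := Metric.tendsto_nhds.1 hcont c hc
      obtain ⟨δ, hδ, hδ'⟩ := Metric.eventually_nhds_iff.1 this
      have e1 : ∀ᶠ τ in nhds τ₀, dist τ τ₀ < δ := Metric.ball_mem_nhds _ hδ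
      have e2 : ∀ᶠ τ in nhds τ₀, dist (m τ) (m τ₀) < δ :=
        hm.continuousAt (Metric.ball_mem_nhds _ hδ)
      filter_upwards [e1, e2] with τ ht1 ht2
      refine (intervalIntegral.norm_integral_le_of_norm_le_const ?_)
      intro s hs
      have hs' : dist s (m τ₀) ≤ dist (m τ) (m τ₀) := by
        have := Set.uIoc_subset_uIcc hs
        rw [dist_comm s, dist_comm (m τ)]
        exact Real.dist_left_le_of_mem_uIcc this
      have := hδ' (y := (τ, s)) (by rw [Prod.dist_eq]; exact max_lt ht1 (hs'.trans_lt ht2))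
      exact this.le
    have := h4.add h3
    rw [zero_add] at this
    refine this.congr_of_eventuallyEq (Eventually.of_forall fun τ => ?_)
    show _ = (∫ s in (m τ₀)..(m τ), (G τ s - G τ₀ (m τ₀))) + (m τ - m τ₀) * G τ₀ (m τ₀)
    rw [intervalIntegral.integral_sub ((hcs τ).intervalIntegrable _ _) (by simp)]
    simp
  refine (h1.sub h2).congr_of_eventuallyEq ?_
  filter_upwards [hball] with τ hτ
  have := intervalIntegral.integral_Ioi_sub_Ioi' (hintg τ hτ) (integrableOn_Ioi_change (b := m τ) (hcs τ) (hintg τ hτ))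
  simp only [Pi.sub_apply]
  linarith

/-- locally uniform decay along characteristics -/
def Qual (e : ℝ) (h : ℝ → ℝ → ℝ) : Prop :=
  ∀ R : ℝ, ∃ M : ℝ, 0 ≤ M ∧ ∀ x s : ℝ, |x| ≤ R → 0 < s → |h (s + x) s| ≤ M * (1 + s) ^ (-e)

lemma integrableOn_one_add_rpow {e t : ℝ} (he : 1 < e) (ht : 0 ≤ t) :
    IntegrableOn (fun s : ℝ => (1 + s) ^ (-e)) (Set.Ioi t) := by
  have := integrableOn_add_rpow_Ioi_of_lt (a := -e) (c := t) (m := 1) (by linarith) (by linarith)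
  simpa [add_comm] using this

lemma Qual.integrableOn {e : ℝ} (he : 1 < e) {h : ℝ → ℝ → ℝ} (hq : Qual e h)
    (hc : Continuous (Function.uncurry h)) (x : ℝ) {t : ℝ} (ht : 0 ≤ t) :
    IntegrableOn (fun s => h (s + x) s) (Set.Ioi t) := by
  obtain ⟨M, hM0, hM⟩ := hq |x|
  refine Integrable.mono' ((integrableOn_one_add_rpow he ht).const_mul M) ?_ ?_
  · exact (hc.comp (by fun_prop : Continuous fun s : ℝ => (s + x, s))).aestronglyMeasurable
  · refine (ae_restrict_mem measurableSet_Ioi).mono fun s hs => ?_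
    exact hM x s le_rfl (ht.trans_lt hs)

lemma Qual.integrable_char {e : ℝ} (he : 1 < e) {h : ℝ → ℝ → ℝ} (hq : Qual e h)
    (hc : Continuous (Function.uncurry h)) (x : ℝ) {t : ℝ} (ht : 0 ≤ t) :
    Integrable (fun s => h (s - t + x) s) (volume.restrict (Set.Ioi t)) := by
  have := hq.integrableOn he hc (x - t) ht
  have h2 : (fun s => h (s + (x - t)) s) = (fun s => h (s - t + x) s) := by
    funext s; congr 1; ring
  rwa [h2] at this

/-- integrals along characteristics -/
def Jint (h : ℝ → ℝ → ℝ) (x t : ℝ) : ℝ := ∫ s in Set.Ioi t, h (s - t + x) s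

lemma affine_bound {c d τ τ₀ : ℝ} (hτ : τ ∈ Metric.ball τ₀ 1) :
    |c * τ + d| ≤ |c| * (|τ₀| + 1) + |d| := by
  have : |τ| ≤ |τ₀| + 1 := by
    have h := (Metric.mem_ball.1 hτ).le
    rw [Real.dist_eq] at h
    have := abs_sub_abs_le_abs_sub τ τ₀
    linarith
  calc |c * τ + d| ≤ |c * τ| + |d| := abs_add_le _ _
    _ ≤ _ := by rw [abs_mul]; gcongr

lemma hasDerivAt_Ioi_single {e : ℝ} (he : 1 < e) {H H' : ℝ → ℝ → ℝ}
    (hHc : Continuous (Function.uncurry H)) (hH'c : Continuous (Function.uncurry H'))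
    (hd : ∀ l s, HasDerivAt (fun l => H l s) (H' l s) l)
    (hq : Qual e H) (hq' : Qual e H') (c d a b τ₀ : ℝ) (h0 : 0 ≤ a * τ₀ + b) :
    HasDerivAt (fun τ => ∫ s in Set.Ioi (a * τ + b), H (s + (c * τ + d)) s)
      ((∫ s in Set.Ioi (a * τ₀ + b), c * H' (s + (c * τ₀ + d)) s)
        - a * H (a * τ₀ + b + (c * τ₀ + d)) (a * τ₀ + b)) τ₀ := by
  obtain ⟨M, hM0, hM⟩ := hq' (|c| * (|τ₀| + 1) + |d|)
  have := leibniz (fun τ s => H (s + (c * τ + d)) s) (fun τ s => c * H' (s + (c * τ + d)) s)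
    (fun τ => a * τ + b) a τ₀ (fun s => |c| * (M * (1 + s) ^ (-e))) ?_ ?_ ?_ ?_ ?_ ?_ ?_
  · exact this
  · simpa using ((hasDerivAt_id τ₀).const_mul a).add_const b
  · exact hHc.comp (by fun_prop : Continuous fun z : ℝ × ℝ => (z.2 + (c * z.1 + d), z.2))
  · exact continuous_const.mul (hH'c.comp (by fun_prop : Continuous fun z : ℝ × ℝ => (z.2 + (c * z.1 + d), z.2)))
  · intro τ _
    exact hq.integrableOn he hHc _ h0
  · intro τ s
    have h1 : HasDerivAt (fun τ => s + (c * τ + d)) c τ := by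
      simpa using (((hasDerivAt_id τ).const_mul c).add_const d).const_add s
    have := (hd (s + (c * τ + d)) s).comp τ h1
    rw [mul_comm]; exact this
  · intro τ hτ s hs
    rw [abs_mul]
    gcongr
    exact hM _ _ (affine_bound hτ) (h0.trans_lt hs)
  · exact ((integrableOn_one_add_rpow he h0).const_mul M).const_mul _

lemma hasDerivAt_Ioi_double {e : ℝ} (he : 1 < e) {H : ℝ → ℝ → ℝ}
    (hHc : Continuous (Function.uncurry H)) 
    (hq : Qual e H) (c₁ d₁ c₂ d₂ a b τ₀ : ℝ) (h0 : 0 ≤ a * τ₀ + b) :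
    HasDerivAt (fun τ => ∫ s in Set.Ioi (a * τ + b),
        ∫ l in (s + (c₁ * τ + d₁))..(s + (c₂ * τ + d₂)), H l s)
      ((∫ s in Set.Ioi (a * τ₀ + b),
          (c₂ * H (s + (c₂ * τ₀ + d₂)) s - c₁ * H (s + (c₁ * τ₀ + d₁)) s))
        - a * ∫ l in (a * τ₀ + b + (c₁ * τ₀ + d₁))..(a * τ₀ + b + (c₂ * τ₀ + d₂)), H l (a * τ₀ + b)) τ₀ := by
  set R := max (|c₁| * (|τ₀| + 1) + |d₁|) (|c₂| * (|τ₀| + 1) + |d₂|) with hR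
  obtain ⟨M, hM0, hM⟩ := hq R
  have hcl : ∀ s, Continuous (fun l => H l s) := fun s =>
    hHc.comp (by fun_prop : Continuous fun l : ℝ => (l, s))
  have hP : Continuous (fun z : ℝ × ℝ => ∫ l in (0:ℝ)..z.1, H l z.2) := by
    apply intervalIntegral.continuous_parametric_intervalIntegral_of_continuous (μ := volume)
      (f := fun (z : ℝ × ℝ) l => H l z.2) (s := fun z : ℝ × ℝ => z.1)
    · exact hHc.comp (by fun_prop : Continuous fun z : (ℝ × ℝ) × ℝ => (z.2, z.1.2))
    · exact continuous_fst
  have hsplit : ∀ x y s, (∫ l in x..y, H l s) = (∫ l in (0:ℝ)..y, H l s) - ∫ l in (0:ℝ)..x, H l s :=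
    fun x y s => by
      rw [intervalIntegral.integral_interval_sub_left] <;> exact (hcl s).intervalIntegrable _ _
  have hGc : Continuous (Function.uncurry fun τ s =>
      ∫ l in (s + (c₁ * τ + d₁))..(s + (c₂ * τ + d₂)), H l s) := by
    have : (Function.uncurry fun τ s : ℝ =>
      ∫ l in (s + (c₁ * τ + d₁))..(s + (c₂ * τ + d₂)), H l s) = fun z : ℝ × ℝ =>
        (∫ l in (0:ℝ)..(z.2 + (c₂ * z.1 + d₂)), H l z.2) - ∫ l in (0:ℝ)..(z.2 + (c₁ * z.1 + d₁)), H l z.2 := by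
      funext z
      exact hsplit _ _ _
    rw [this]
    exact (hP.comp (by fun_prop : Continuous fun z : ℝ × ℝ => (z.2 + (c₂ * z.1 + d₂), z.2))).sub
      (hP.comp (by fun_prop : Continuous fun z : ℝ × ℝ => (z.2 + (c₁ * z.1 + d₁), z.2)))
  have hmem : ∀ c d τ, HasDerivAt (fun τ : ℝ => c * τ + d) c τ := fun c d τ => by
    simpa using ((hasDerivAt_id τ).const_mul c).add_const d
  have := leibniz (fun τ s => ∫ l in (s + (c₁ * τ + d₁))..(s + (c₂ * τ + d₂)), H l s)
    (fun τ s => (c₂ * H (s + (c₂ * τ + d₂)) s - c₁ * H (s + (c₁ * τ + d₁)) s))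
    (fun τ => a * τ + b) a τ₀ (fun s => (|c₂| + |c₁|) * (M * (1 + s) ^ (-e))) (hmem _ _ _) hGc ?_ ?_ ?_ ?_ ?_
  · exact this
  · exact (continuous_const.mul (hHc.comp (by fun_prop : Continuous fun z : ℝ × ℝ => (z.2 + (c₂ * z.1 + d₂), z.2)))).sub
      (continuous_const.mul (hHc.comp (by fun_prop : Continuous fun z : ℝ × ℝ => (z.2 + (c₁ * z.1 + d₁), z.2))))
  · intro τ hτ
    refine Integrable.mono' (((integrableOn_one_add_rpow he h0).const_mul M).mul_const (|c₂ * τ + d₂ - (c₁ * τ + d₁)|)) ?_ ?_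
    · exact (hGc.comp (by fun_prop : Continuous fun s : ℝ => (τ, s))).aestronglyMeasurable
    · refine (ae_restrict_mem measurableSet_Ioi).mono fun s hs => ?_
      have := intervalIntegral.norm_integral_le_of_norm_le_const (f := fun l => H l s)
        (a := s + (c₁ * τ + d₁)) (b := s + (c₂ * τ + d₂)) (C := M * (1 + s) ^ (-e)) ?_
      · simpa using this
      · intro l hl
        have hl' : l - s ∈ Set.uIcc (c₁ * τ + d₁) (c₂ * τ + d₂) := by
          have := Set.uIoc_subset_uIcc hl
          rw [Set.mem_uIcc] at this ⊢
          rcases this with h | h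
          · left; constructor <;> linarith [h.1, h.2]
          · right; constructor <;> linarith [h.1, h.2]
        have hb : |l - s| ≤ R := by
          have h1 := (affine_bound (c := c₁) (d := d₁) hτ).trans (le_max_left _ _ : _ ≤ R)
          have h2 := (affine_bound (c := c₂) (d := d₂) hτ).trans (le_max_right _ _ : _ ≤ R)
          rw [abs_le] at h1 h2 ⊢
          rw [Set.mem_uIcc] at hl'
          rcases hl' with h | h
          · constructor <;> linarith [h.1, h.2]
          · constructor <;> linarith [h.1, h.2]
        have := hM (l - s) s hb (h0.trans_lt hs)
        simpa using this
  · intro τ s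
    have hFT : ∀ y, HasDerivAt (fun y => ∫ l in (0:ℝ)..y, H l s) (H y s) y := fun y =>
      intervalIntegral.integral_hasDerivAt_right ((hcl s).intervalIntegrable _ _)
        ((hcl s).stronglyMeasurableAtFilter _ _) (hcl s).continuousAt
    have k2 := (hFT (s + (c₂ * τ + d₂))).comp τ ((hmem c₂ d₂ τ).const_add s)
    have k1 := (hFT (s + (c₁ * τ + d₁))).comp τ ((hmem c₁ d₁ τ).const_add s)
    have := k2.sub k1
    rw [mul_comm c₂, mul_comm c₁]
    refine this.congr_of_eventuallyEq (Eventually.of_forall fun τ => ?_)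
    exact hsplit _ _ _
  · intro τ hτ s hs
    have h1 := hM _ s ((affine_bound (c := c₁) (d := d₁) hτ).trans (le_max_left _ _ : _ ≤ R)) (h0.trans_lt hs)
    have h2 := hM _ s ((affine_bound (c := c₂) (d := d₂) hτ).trans (le_max_right _ _ : _ ≤ R)) (h0.trans_lt hs)
    calc |c₂ * H (s + (c₂ * τ + d₂)) s - c₁ * H (s + (c₁ * τ + d₁)) s|
        ≤ |c₂ * H (s + (c₂ * τ + d₂)) s| + |c₁ * H (s + (c₁ * τ + d₁)) s| := abs_sub _ _
      _ ≤ |c₂| * (M * (1 + s) ^ (-e)) + |c₁| * (M * (1 + s) ^ (-e)) := by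
          rw [abs_mul, abs_mul]; gcongr
      _ = _ := by ring
  · exact ((integrableOn_one_add_rpow he h0).const_mul M).const_mul _

/-- numerator of the final value operator -/
def Iint (H : ℝ → ℝ → ℝ) (r t : ℝ) : ℝ :=
  ∫ s in Set.Ioi t, ∫ l in ((s - t) - r)..((s - t) + r), H l s

section
variable {e : ℝ} {H H' : ℝ → ℝ → ℝ}

lemma Jint_x (he : 1 < e) (hHc : Continuous (Function.uncurry H)) (hH'c : Continuous (Function.uncurry H')) (hd : ∀ l s, HasDerivAt (fun l => H l s) (H' l s) l) (hq : Qual e H) (hq' : Qual e H') {x t : ℝ} (ht : 0 ≤ t) : HasDerivAt (fun x => Jint H x t) (Jint H' x t) x := by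
  have := hasDerivAt_Ioi_single he hHc hH'c hd hq hq' 1 (-t) 0 t x (by simpa using ht)
  convert! this using 1
  · funext y
    simp only [Jint]
    congr 1
    · simp
    · funext s; congr 1; ring
  · simp only [Jint, zero_mul, sub_zero, zero_add, one_mul]
    congr 1
    funext s; congr 1; ring

lemma Jint_t (he : 1 < e) (hHc : Continuous (Function.uncurry H)) (hH'c : Continuous (Function.uncurry H')) (hd : ∀ l s, HasDerivAt (fun l => H l s) (H' l s) l) (hq : Qual e H) (hq' : Qual e H') {x t : ℝ} (ht : 0 ≤ t) :
    HasDerivAt (fun t => Jint H x t) (-(Jint H' x t) - H x t) t := by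
  have := hasDerivAt_Ioi_single he hHc hH'c hd hq hq' (-1) x 1 0 t (by simpa using ht)
  convert! this using 1
  · funext y
    simp only [Jint]
    congr 1
    · simp
    · funext s; congr 1; ring
  · simp only [Jint, one_mul, add_zero, neg_mul]
    rw [integral_neg]
    congr 1
    · congr 2
      funext s; congr 1; ring
    · congr 1; ring

lemma integral_odd (hodd : ∀ l s, H (-l) s = - H l s) (r s : ℝ) : ∫ l in (-r)..r, H l s = 0 := by
  have h1 : ∫ l in (-r)..r, H (-l) s = ∫ l in (-r)..r, H l s := by
    rw [intervalIntegral.integral_comp_neg (fun l => H l s)]; simp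
  simp only [hodd] at h1
  rw [intervalIntegral.integral_neg] at h1
  linarith

lemma Iint_r (he : 1 < e) (hHc : Continuous (Function.uncurry H)) (hq : Qual e H) {r t : ℝ} (ht : 0 ≤ t) :
    HasDerivAt (fun r => Iint H r t) (Jint H r t + Jint H (-r) t) r := by
  have := hasDerivAt_Ioi_double he hHc hq (-1) (-t) 1 (-t) 0 t r (by simpa using ht)
  convert! this using 1
  · funext y
    simp only [Iint]
    congr 1
    · simp
    · funext s; congr 1 <;> ring
  · simp only [Jint, one_mul, zero_mul, sub_zero, zero_add, neg_mul, sub_neg_eq_add]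
    rw [← integral_add]
    · congr 1
      funext s
      congr 2 <;> ring
    · exact hq.integrable_char he hHc _ ht
    · exact hq.integrable_char he hHc _ ht

lemma Iint_t (he : 1 < e) (hHc : Continuous (Function.uncurry H)) (hodd : ∀ l s, H (-l) s = - H l s) (hq : Qual e H) {r t : ℝ} (ht : 0 ≤ t) :
    HasDerivAt (fun t => Iint H r t) (Jint H (-r) t - Jint H r t) t := by
  have := hasDerivAt_Ioi_double he hHc hq (-1) (-r) (-1) r 1 0 t (by simpa using ht)
  convert! this using 1
  · funext y
    simp only [Iint]
    congr 1
    · simp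
    · funext s; congr 1 <;> ring
  · have h0 : (∫ l in (1 * t + 0 + (-1 * t + -r))..(1 * t + 0 + (-1 * t + r)), H l (1 * t + 0)) = 0 := by
      rw [show 1 * t + 0 + (-1 * t + -r) = -r by ring, show 1 * t + 0 + (-1 * t + r) = r by ring]
      exact integral_odd hodd _ _
    rw [h0]
    simp only [Jint, one_mul, mul_zero, sub_zero, add_zero, neg_mul, sub_neg_eq_add]
    rw [← integral_sub]
    · congr 1
      funext s
      rw [show s - t + -r = s + (-t + -r) by ring, show s - t + r = s + (-t + r) by ring]
      ring
    · exact hq.integrable_char he hHc _ ht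
    · exact hq.integrable_char he hHc _ ht

lemma Iint_diag (he : 1 < e) (hHc : Continuous (Function.uncurry H)) (hodd : ∀ l s, H (-l) s = - H l s) (hq : Qual e H) {M t : ℝ} (ht : 0 ≤ t) :
    HasDerivAt (fun t => Iint H (M - t) t) (-2 * Jint H (M - t) t) t := by
  have := hasDerivAt_Ioi_double he hHc hq 0 (-M) (-2) M 1 0 t (by simpa using ht)
  convert! this using 1
  · funext y
    simp only [Iint]
    congr 1
    · simp
    · funext s; congr 1 <;> ring
  · have h0 : (∫ l in (1 * t + 0 + (0 * t + -M))..(1 * t + 0 + (-2 * t + M)), H l (1 * t + 0)) = 0 := by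
      rw [show 1 * t + 0 + (0 * t + -M) = -(M - t) by ring, show 1 * t + 0 + (-2 * t + M) = M - t by ring]
      exact integral_odd hodd _ _
    rw [h0]
    simp only [Jint, one_mul, mul_zero, sub_zero, add_zero, zero_mul]
    rw [← integral_const_mul]
    congr 1
    funext s
    rw [show s - t + (M - t) = s + (-2 * t + M) by ring]

end

def Wt (κ γ l s : ℝ) : ℝ := l ^ (-κ) * (1 + |l - s|) ^ (-(1 + κ)) * (1 + l + s) ^ (-γ)

lemma rpow_anti {x y e : ℝ} (hx : 0 < x) (hxy : x ≤ y) (he : 0 ≤ e) : y ^ (-e) ≤ x ^ (-e) :=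
  Real.rpow_le_rpow_of_nonpos hx hxy (by linarith)

lemma sig_integrable {κ γ : ℝ} (hκ : 0 < κ) (hκ1 : κ < 1) (hγ : 0 < γ) (he : 1 < κ + γ) :
    IntegrableOn (fun σ : ℝ => σ ^ (-κ) * (1 + σ) ^ (-γ)) (Set.Ioi 0) := by
  have hm : Measurable (fun σ : ℝ => σ ^ (-κ) * (1 + σ) ^ (-γ)) := by fun_prop
  rw [← Set.Ioc_union_Ioi_eq_Ioi (zero_le_one (α := ℝ))]
  refine IntegrableOn.union ?_ ?_
  · have h1 : IntegrableOn (fun σ : ℝ => σ ^ (-κ)) (Set.Ioc 0 1) := by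
      rw [← intervalIntegrable_iff_integrableOn_Ioc_of_le zero_le_one]
      exact intervalIntegral.intervalIntegrable_rpow' (by linarith)
    refine Integrable.mono' h1 hm.aestronglyMeasurable ?_
    refine (ae_restrict_mem measurableSet_Ioc).mono fun s hs => ?_
    have hs0 : 0 < s := hs.1
    have h2 : (1 + s) ^ (-γ) ≤ 1 :=
      Real.rpow_le_one_of_one_le_of_nonpos (by linarith) (by linarith)
    rw [Real.norm_of_nonneg (by positivity)]
    exact mul_le_of_le_one_right (by positivity) h2
  · have h1 : IntegrableOn (fun σ : ℝ => σ ^ (-κ - γ)) (Set.Ioi 1) :=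
      integrableOn_Ioi_rpow_of_lt (by linarith) one_pos
    refine Integrable.mono' h1 hm.aestronglyMeasurable ?_
    refine (ae_restrict_mem measurableSet_Ioi).mono fun s hs => ?_
    have hs0 : 0 < s := one_pos.trans hs
    rw [Real.norm_of_nonneg (by positivity), sub_eq_add_neg, Real.rpow_add hs0]
    gcongr ?_ * ?_
    exact rpow_anti hs0 (by linarith) hγ.le

def sigC (κ γ : ℝ) : ℝ := ∫ σ in Set.Ioi (0:ℝ), σ ^ (-κ) * (1 + σ) ^ (-γ)

lemma sigC_nonneg (κ γ : ℝ) : 0 ≤ sigC κ γ := by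
  refine setIntegral_nonneg measurableSet_Ioi fun s hs => ?_
  have hs0 : (0:ℝ) < s := hs
  positivity

lemma sig_scale {κ γ T : ℝ} (hκ : 0 < κ) (hκ1 : κ < 1) (hγ : 0 < γ) (he : 1 < κ + γ) (hT : 1 ≤ T) (b : ℝ) :
    IntegrableOn (fun s : ℝ => (s - b) ^ (-κ) * (T + (s - b)) ^ (-γ)) (Set.Ioi b) ∧
    ∫ s in Set.Ioi b, (s - b) ^ (-κ) * (T + (s - b)) ^ (-γ) = sigC κ γ * T ^ (1 - κ - γ) := by
  have hT0 : 0 < T := by linarith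
  have hTi : 0 < T⁻¹ := inv_pos.2 hT0
  have key : Set.EqOn (fun σ : ℝ => T ^ (-κ - γ) * ((T⁻¹ * σ) ^ (-κ) * (1 + T⁻¹ * σ) ^ (-γ)))
      (fun σ : ℝ => σ ^ (-κ) * (T + σ) ^ (-γ)) (Set.Ioi 0) := by
    intro σ hσ
    have hs : (0:ℝ) < σ := hσ
    show T ^ (-κ - γ) * ((T⁻¹ * σ) ^ (-κ) * (1 + T⁻¹ * σ) ^ (-γ)) = σ ^ (-κ) * (T + σ) ^ (-γ)
    have h1 : 1 + T⁻¹ * σ = T⁻¹ * (T + σ) := by field_simp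
    rw [h1, Real.mul_rpow hTi.le hs.le, Real.mul_rpow hTi.le (by linarith), sub_eq_add_neg,
      Real.rpow_add hT0, Real.inv_rpow hT0.le, Real.inv_rpow hT0.le]
    have := Real.rpow_pos_of_pos hT0 (-κ)
    have := Real.rpow_pos_of_pos hT0 (-γ)
    field_simp
  have hintg0 : IntegrableOn (fun σ : ℝ => σ ^ (-κ) * (T + σ) ^ (-γ)) (Set.Ioi 0) := by
    refine IntegrableOn.congr_fun ?_ key measurableSet_Ioi
    refine Integrable.const_mul ?_ _
    have := (integrableOn_Ioi_comp_mul_left_iff (fun σ : ℝ => σ ^ (-κ) * (1 + σ) ^ (-γ)) 0 hTi).2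
      (by simpa using sig_integrable hκ hκ1 hγ he)
    exact this
  have hval0 : ∫ σ in Set.Ioi (0:ℝ), σ ^ (-κ) * (T + σ) ^ (-γ) = sigC κ γ * T ^ (1 - κ - γ) := by
    rw [← setIntegral_congr_fun measurableSet_Ioi key, integral_const_mul,
      integral_comp_mul_left_Ioi (fun σ : ℝ => σ ^ (-κ) * (1 + σ) ^ (-γ)) 0 hTi]
    rw [mul_zero, inv_inv, smul_eq_mul, show 1 - κ - γ = 1 + (-κ - γ) by ring, Real.rpow_add hT0,
      Real.rpow_one, sigC]
    ring
  have hpre : (fun s : ℝ => s - b) ⁻¹' (Set.Ioi 0) = Set.Ioi b := by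
    ext s; simp
  have hmp := measurePreserving_sub_right (volume : Measure ℝ) b
  have hemb := (MeasurableEquiv.subRight b).measurableEmbedding
  constructor
  · have := (hmp.integrableOn_comp_preimage hemb (s := Set.Ioi 0)
      (f := fun σ : ℝ => σ ^ (-κ) * (T + σ) ^ (-γ))).2 hintg0
    rw [hpre] at this
    exact this
  · have := hmp.setIntegral_preimage_emb hemb (fun σ : ℝ => σ ^ (-κ) * (T + σ) ^ (-γ)) (Set.Ioi 0)
    rw [hpre] at this
    rw [this, hval0]

lemma Jp_bound {κ γ A : ℝ} (hκ : 0 < κ) (hκ1 : κ < 1) (hγ : 0 < γ) (he : 1 < κ + γ) (hA : 0 ≤ A)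
    {h : ℝ → ℝ → ℝ} (hW : ∀ l s, l ≠ 0 → 0 < s → |h l s| ≤ A * Wt κ γ |l| s)
    {r t : ℝ} (hr : 0 < r) (ht : 0 ≤ t) :
    |Jint h r t| ≤ sigC κ γ * A * (1 + |r - t|) ^ (-(1 + κ)) * (1 + r + t) ^ (1 - κ - γ) := by
  have hT : 1 ≤ 1 + r + t := by linarith
  obtain ⟨h1, h2⟩ := sig_scale hκ hκ1 hγ he hT t
  have := norm_integral_le_of_norm_le (f := fun s => h (s - t + r) s)
    (h1.const_mul (A * (1 + |r - t|) ^ (-(1 + κ)))) ?_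
  · rw [integral_const_mul, h2] at this
    refine this.trans (le_of_eq (by ring))
  · refine (ae_restrict_mem measurableSet_Ioi).mono fun s hs => ?_
    have hs' : t < s := hs
    have hl : 0 < s - t + r := by linarith
    refine (hW _ s hl.ne' (by linarith)).trans ?_
    rw [abs_of_pos hl, Wt]
    have e1 : s - t + r - s = r - t := by ring
    rw [e1]
    have hst : 0 < s - t := by linarith
    have b1 : (s - t + r) ^ (-κ) ≤ (s - t) ^ (-κ) := rpow_anti hst (by linarith) hκ.le
    have b3 : 0 < 1 + (s - t + r) + s := by linarith
    have b2 : (1 + (s - t + r) + s) ^ (-γ) ≤ (1 + r + t + (s - t)) ^ (-γ) :=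
      rpow_anti (by linarith) (by linarith) hγ.le
    calc A * ((s - t + r) ^ (-κ) * (1 + |r - t|) ^ (-(1 + κ)) * (1 + (s - t + r) + s) ^ (-γ))
        ≤ A * ((s - t) ^ (-κ) * (1 + |r - t|) ^ (-(1 + κ)) * (1 + r + t + (s - t)) ^ (-γ)) := by
          gcongr
      _ = _ := by ring

def B0 (κ : ℝ) : ℝ := ∫ x : ℝ, (1 + |x|) ^ (-(1 + κ))

lemma B0_integrable {κ : ℝ} (hκ : 0 < κ) : Integrable (fun x : ℝ => (1 + |x|) ^ (-(1 + κ))) := by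
  have := integrable_one_add_norm (E := ℝ) (μ := volume) (r := 1 + κ) (by simpa using hκ)
  simpa using this

lemma B0_nonneg (κ : ℝ) : 0 ≤ B0 κ := integral_nonneg fun x => by positivity

lemma B0_cont (κ M : ℝ) : Continuous (fun s : ℝ => (1 + |M - 2 * s|) ^ (-(1 + κ))) := by
  refine Continuous.rpow_const (by fun_prop) fun s => Or.inl ?_
  positivity

lemma B0_bound {κ : ℝ} (hκ : 0 < κ) (M : ℝ) {a b : ℝ} (hab : a ≤ b) :
    ∫ s in a..b, (1 + |M - 2 * s|) ^ (-(1 + κ)) ≤ B0 κ := by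
  rw [intervalIntegral.integral_comp_sub_mul (fun x : ℝ => (1 + |x|) ^ (-(1 + κ))) two_ne_zero M,
    intervalIntegral.integral_of_le (by linarith)]
  have h1 : ∫ x in Set.Ioc (M - 2 * b) (M - 2 * a), (1 + |x|) ^ (-(1 + κ)) ≤ B0 κ :=
    setIntegral_le_integral (B0_integrable hκ) (Eventually.of_forall fun x => by
      show 0 ≤ (1 + |x|) ^ (-(1 + κ)); positivity)
  have h0 := B0_nonneg κ
  rw [smul_eq_mul]
  linarith

lemma mid_pointwise {κ M μ : ℝ} (hκ : 0 < κ) (hκ1 : κ < 1) (hM : 0 ≤ M) (hμ : 0 < μ) :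
    μ ^ (-κ) * (1 + |M - 2 * μ|) ^ (-(1 + κ)) ≤
      8 * ((1 + M) ^ (-κ) * (1 + |M - 2 * μ|) ^ (-(1 + κ)) + μ ^ (-κ) * (1 + M) ^ (-(1 + κ))) := by
  have hT : 0 < 1 + M := by linarith
  have p1 : 0 ≤ (1 + M) ^ (-κ) * (1 + |M - 2 * μ|) ^ (-(1 + κ)) := by positivity
  have p2 : 0 ≤ μ ^ (-κ) * (1 + M) ^ (-(1 + κ)) := by positivity
  rcases le_or_gt (1 + M) (4 * μ) with h | h
  · have b1 : μ ^ (-κ) ≤ 8 * (1 + M) ^ (-κ) := by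
      calc μ ^ (-κ) ≤ ((1 + M) / 4) ^ (-κ) := rpow_anti (by linarith) (by linarith) hκ.le
        _ = (1 + M) ^ (-κ) * 4 ^ κ := by
          rw [Real.div_rpow hT.le (by norm_num), Real.rpow_neg (by norm_num : (0:ℝ) ≤ 4), div_inv_eq_mul]
        _ ≤ (1 + M) ^ (-κ) * 4 ^ (1:ℝ) := by
          gcongr
          norm_num
        _ ≤ _ := by
          rw [Real.rpow_one]
          have : 0 ≤ (1 + M) ^ (-κ) := by positivity
          linarith
    calc _ ≤ (8 * (1 + M) ^ (-κ)) * (1 + |M - 2 * μ|) ^ (-(1 + κ)) := by gcongr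
      _ ≤ _ := by linarith
  · have b0 : (1 + M) / 2 ≤ 1 + |M - 2 * μ| := by
      have := le_abs_self (M - 2 * μ)
      linarith
    have b1 : (1 + |M - 2 * μ|) ^ (-(1 + κ)) ≤ 8 * (1 + M) ^ (-(1 + κ)) := by
      calc _ ≤ ((1 + M) / 2) ^ (-(1 + κ)) := rpow_anti (by linarith) b0 (by linarith)
        _ = (1 + M) ^ (-(1 + κ)) * 2 ^ (1 + κ) := by
          rw [Real.div_rpow hT.le (by norm_num), Real.rpow_neg (by norm_num : (0:ℝ) ≤ 2), div_inv_eq_mul]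
        _ ≤ (1 + M) ^ (-(1 + κ)) * 2 ^ (2:ℝ) := by
          gcongr
          · norm_num
          · linarith
        _ ≤ _ := by
          have : 0 ≤ (1 + M) ^ (-(1 + κ)) := by positivity
          have h2 : (2:ℝ) ^ (2:ℝ) = 4 := by norm_num
          rw [h2]
          linarith
    calc _ ≤ μ ^ (-κ) * (8 * (1 + M) ^ (-(1 + κ))) := by gcongr
      _ ≤ _ := by linarith

def CJ (κ γ : ℝ) : ℝ := 8 * B0 κ + 8 / (1 - κ) + sigC κ γ

lemma Jm_bound {κ γ A e : ℝ} (hκ : 0 < κ) (hκ1 : κ < 1) (hγ : 0 < γ) (he : 1 < κ + γ) (hA : 0 ≤ A)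
    {h : ℝ → ℝ → ℝ} (he' : 1 < e) (hc : Continuous (Function.uncurry h)) (hq : Qual e h)
    (hW : ∀ l s, l ≠ 0 → 0 < s → |h l s| ≤ A * Wt κ γ |l| s)
    {r t : ℝ} (hr : 0 < r) (ht : 0 ≤ t) :
    |Jint h (-r) t| ≤ CJ κ γ * A * (1 + r + t) ^ (-κ - γ) := by
  have hT : 1 ≤ 1 + r + t := by linarith
  have hT0 : 0 < 1 + r + t := by linarith
  have hintg := hq.integrable_char he' hc (-r) ht
  have htM : t ≤ r + t := by linarith
  have hsplit : Jint h (-r) t = (∫ s in t..(r + t), h (s - t + -r) s) +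
      ∫ s in Set.Ioi (r + t), h (s - t + -r) s := by
    rw [Jint, ← Set.Ioc_union_Ioi_eq_Ioi htM, setIntegral_union, intervalIntegral.integral_of_le htM]
    · exact Set.Ioc_disjoint_Ioi le_rfl
    · exact measurableSet_Ioi
    · exact IntegrableOn.mono_set hintg Set.Ioc_subset_Ioi_self
    · exact IntegrableOn.mono_set hintg (Set.Ioi_subset_Ioi htM)
  -- far part
  have hfar : |∫ s in Set.Ioi (r + t), h (s - t + -r) s| ≤
      sigC κ γ * A * (1 + r + t) ^ (-κ - γ) := by
    obtain ⟨h1, h2⟩ := sig_scale hκ hκ1 hγ he hT (r + t)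
    have := norm_integral_le_of_norm_le (f := fun s => h (s - t + -r) s)
      (h1.const_mul (A * (1 + r + t) ^ (-(1 + κ)))) ?_
    · rw [integral_const_mul, h2] at this
      refine this.trans ?_
      have e1 : (1 + r + t) ^ (-(1 + κ)) * (1 + r + t) ^ (1 - κ - γ) ≤ (1 + r + t) ^ (-κ - γ) := by
        rw [← Real.rpow_add hT0]
        exact Real.rpow_le_rpow_of_exponent_le hT (by linarith)
      calc _ = sigC κ γ * A * ((1 + r + t) ^ (-(1 + κ)) * (1 + r + t) ^ (1 - κ - γ)) := by ring
        _ ≤ _ := by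
          have := sigC_nonneg κ γ
          gcongr
    · refine (ae_restrict_mem measurableSet_Ioi).mono fun s hs => ?_
      have hs' : r + t < s := hs
      have hl : 0 < s - t + -r := by linarith
      refine (hW _ s hl.ne' (by linarith)).trans ?_
      rw [abs_of_pos hl, Wt]
      have e1 : 1 + |s - t + -r - s| = 1 + r + t := by
        rw [show s - t + -r - s = -(r + t) by ring, abs_neg, abs_of_nonneg (by linarith)]; ring
      have hst : 0 < s - (r + t) := by linarith
      rw [e1, show s - t + -r = s - (r + t) by ring]
      have b2 : (1 + (s - (r + t)) + s) ^ (-γ) ≤ (1 + r + t + (s - (r + t))) ^ (-γ) :=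
        rpow_anti (by linarith) (by linarith) hγ.le
      calc A * ((s - (r + t)) ^ (-κ) * (1 + r + t) ^ (-(1 + κ)) * (1 + (s - (r + t)) + s) ^ (-γ))
          ≤ A * ((s - (r + t)) ^ (-κ) * (1 + r + t) ^ (-(1 + κ)) * (1 + r + t + (s - (r + t))) ^ (-γ)) := by
            gcongr
        _ = _ := by ring
  -- near part
  have hnear : |∫ s in t..(r + t), h (s - t + -r) s| ≤
      (8 * B0 κ + 8 / (1 - κ)) * A * (1 + r + t) ^ (-κ - γ) := by
    have i1 : IntervalIntegrable (fun s : ℝ => (1 + |(r + t) - 2 * s|) ^ (-(1 + κ))) volume t (r + t) :=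
      (B0_cont κ (r + t)).intervalIntegrable _ _
    have i2 : IntervalIntegrable (fun s : ℝ => ((r + t) - s) ^ (-κ)) volume t (r + t) := by
      have := (intervalIntegral.intervalIntegrable_rpow' (a := r) (b := 0) (r := -κ) (by linarith)).comp_sub_left (r + t)
      simpa using this
    have v2 : ∫ s in t..(r + t), ((r + t) - s) ^ (-κ) = r ^ (1 - κ) / (1 - κ) := by
      rw [intervalIntegral.integral_comp_sub_left (fun x : ℝ => x ^ (-κ)) (r + t)]
      rw [integral_rpow (Or.inl (by linarith))]
      rw [show r + t - (r + t) = 0 by ring, show r + t - t = r by ring,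
        Real.zero_rpow (by linarith), show -κ + 1 = 1 - κ by ring, sub_zero]
    have hg : IntervalIntegrable (fun s : ℝ => A * (1 + r + t) ^ (-γ) * (8 *
        ((1 + r + t) ^ (-κ) * (1 + |(r + t) - 2 * s|) ^ (-(1 + κ)) +
          ((r + t) - s) ^ (-κ) * (1 + r + t) ^ (-(1 + κ))))) volume t (r + t) :=
      (((i1.const_mul _).add (i2.mul_const _)).const_mul _).const_mul _
    have := intervalIntegral.norm_integral_le_of_norm_le (f := fun s => h (s - t + -r) s) htM ?_ hg
    · refine this.trans ?_
      rw [intervalIntegral.integral_const_mul, intervalIntegral.integral_const_mul,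
        intervalIntegral.integral_add (i1.const_mul _) (i2.mul_const _),
        intervalIntegral.integral_const_mul, intervalIntegral.integral_mul_const, v2]
      have hB := B0_bound hκ (r + t) htM
      have h1k : 0 < 1 - κ := by linarith
      have hr1 : r ^ (1 - κ) ≤ (1 + r + t) ^ (1 - κ) := by gcongr; linarith
      have e2 : (1 + r + t) ^ (1 - κ) * (1 + r + t) ^ (-(1 + κ)) ≤ (1 + r + t) ^ (-κ) := by
        rw [← Real.rpow_add hT0]
        exact Real.rpow_le_rpow_of_exponent_le hT (by linarith)
      have e3 : (1 + r + t) ^ (-κ - γ) = (1 + r + t) ^ (-κ) * (1 + r + t) ^ (-γ) := by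
        rw [← Real.rpow_add hT0]; congr 1
      have e4 : r ^ (1 - κ) / (1 - κ) * (1 + r + t) ^ (-(1 + κ)) ≤ (1 + r + t) ^ (-κ) / (1 - κ) := by
        rw [div_mul_eq_mul_div]
        gcongr
        exact le_trans (by gcongr) e2
      calc _ ≤ A * (1 + r + t) ^ (-γ) * (8 * ((1 + r + t) ^ (-κ) * B0 κ + (1 + r + t) ^ (-κ) / (1 - κ))) := by
            gcongr
        _ = _ := by rw [e3]; ring
    · have hne : ∀ᵐ s : ℝ, s ≠ r + t := by simp [ae_iff]
      filter_upwards [hne] with s hs hs2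
      have hs3 : 0 < (r + t) - s := by
        have := lt_of_le_of_ne hs2.2 hs
        linarith
      have hl : s - t + -r ≠ 0 := by
        intro h0; linarith
      refine (hW _ s hl (by linarith [hs2.1])).trans ?_
      have e1 : |s - t + -r| = (r + t) - s := by
        rw [abs_of_neg (by linarith)]; ring
      rw [e1, Wt, show 1 + (r + t - s) + s = 1 + r + t by ring,
        show r + t - s - s = r + t - 2 * s by ring]
      have := mid_pointwise (M := r + t) hκ hκ1 (by linarith) hs3
      have e2 : |r + t - 2 * (r + t - s)| = |r + t - 2 * s| := by
        rw [← abs_neg]; congr 1; ring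
      rw [e2, show 1 + (r + t) = 1 + r + t by ring] at this
      calc _ = A * (1 + r + t) ^ (-γ) * ((r + t - s) ^ (-κ) * (1 + |r + t - 2 * s|) ^ (-(1 + κ))) := by ring
        _ ≤ _ := by gcongr
  rw [hsplit]
  refine (abs_add_le _ _).trans ?_
  rw [CJ]
  linarith

def CI (κ γ : ℝ) : ℝ := 8 * sigC κ γ * (B0 κ + 1)

lemma Iint_zero (H : ℝ → ℝ → ℝ) (t : ℝ) : Iint H 0 t = 0 := by
  simp [Iint]

lemma I_bound {κ γ A e : ℝ} (hκ : 0 < κ) (hκ1 : κ < 1) (hγ : 0 < γ) (he : 1 < κ + γ) (hA : 0 ≤ A)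
    {H : ℝ → ℝ → ℝ} (he' : 1 < e) (hc : Continuous (Function.uncurry H)) (hq : Qual e H)
    (hodd : ∀ l s, H (-l) s = - H l s)
    (hW : ∀ l s, l ≠ 0 → 0 < s → |H l s| ≤ A * Wt κ γ |l| s)
    {r t : ℝ} (hr : 0 < r) (ht : 0 ≤ t) :
    |Iint H r t| ≤ r * (CI κ γ * A * (1 + r + t) ^ (-κ - γ)) := by
  have hT : 1 ≤ 1 + r + t := by linarith
  have hT0 : 0 < 1 + r + t := by linarith
  have htM : t ≤ r + t := by linarith
  have hS := sigC_nonneg κ γ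
  have hB := B0_nonneg κ
  have hder : ∀ τ, 0 ≤ τ → HasDerivAt (fun τ => Iint H (r + t - τ) τ) (-2 * Jint H (r + t - τ) τ) τ :=
    fun τ hτ => Iint_diag he' hc hodd hq hτ
  have hbd : ∀ τ, τ ∈ Set.Ioo t (r + t) → |-2 * Jint H (r + t - τ) τ| ≤
      2 * sigC κ γ * A * (1 + r + t) ^ (1 - κ - γ) * (1 + |(r + t) - 2 * τ|) ^ (-(1 + κ)) := by
    intro τ hτ
    have := Jp_bound hκ hκ1 hγ he hA hW (r := r + t - τ) (t := τ) (by linarith [hτ.2]) (ht.trans hτ.1.le)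
    rw [show r + t - τ - τ = r + t - 2 * τ by ring, show 1 + (r + t - τ) + τ = 1 + r + t by ring] at this
    rw [abs_mul, abs_neg, abs_two]
    linarith
  have main : ∀ B : ℝ → ℝ, Continuous B → (∀ τ, τ ∈ Set.Ioo t (r + t) → |-2 * Jint H (r + t - τ) τ| ≤ B τ) →
      |Iint H r t| ≤ ∫ τ in t..(r + t), B τ := by
    intro B hBc hB
    have := norm_sub_le_integral_of_norm_deriv_le_of_le (f := fun τ => Iint H (r + t - τ) τ) (B := B) htM ?_ ?_ ?_
      (hBc.intervalIntegrable _ _)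
    · simp only [sub_self, Iint_zero, zero_sub, norm_neg] at this
      rwa [show r + t - t = r by ring] at this
    · intro τ hτ
      exact (hder τ (ht.trans hτ.1)).continuousAt.continuousWithinAt
    · intro τ hτ
      exact (hder τ (ht.trans hτ.1.le)).differentiableAt.differentiableWithinAt
    · refine Eventually.of_forall fun τ hτ => ?_
      rw [(hder τ (ht.trans hτ.1.le)).deriv]
      exact hB τ hτ
  have eT : (1 + r + t) ^ (1 - κ - γ) = (1 + r + t) * (1 + r + t) ^ (-κ - γ) := by
    rw [show 1 - κ - γ = 1 + (-κ - γ) by ring, Real.rpow_add hT0, Real.rpow_one]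
  have pT : 0 ≤ (1 + r + t) ^ (-κ - γ) := by positivity
  rcases le_or_gt (1 + r + t) (4 * r) with h | h
  · have := main (fun τ => 2 * sigC κ γ * A * (1 + r + t) ^ (1 - κ - γ) * (1 + |(r + t) - 2 * τ|) ^ (-(1 + κ)))
      (continuous_const.mul (B0_cont κ (r + t))) hbd
    rw [intervalIntegral.integral_const_mul, eT] at this
    refine this.trans ?_
    have hb := B0_bound hκ (r + t) htM
    calc _ ≤ 2 * sigC κ γ * A * ((1 + r + t) * (1 + r + t) ^ (-κ - γ)) * B0 κ := by gcongr
      _ ≤ 2 * sigC κ γ * A * ((4 * r) * (1 + r + t) ^ (-κ - γ)) * B0 κ := by gcongr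
      _ ≤ 2 * sigC κ γ * A * ((4 * r) * (1 + r + t) ^ (-κ - γ)) * (B0 κ + 1) := by
          gcongr; linarith
      _ = _ := by rw [CI]; ring
  · have := main (fun _ => 2 * sigC κ γ * A * (1 + r + t) ^ (1 - κ - γ) * (4 / (1 + r + t))) continuous_const ?_
    · rw [intervalIntegral.integral_const, eT, smul_eq_mul] at this
      refine this.trans ?_
      calc _ = r * (8 * sigC κ γ * A * (1 + r + t) ^ (-κ - γ)) := by field_simp; ring
        _ ≤ _ := by
          rw [CI]
          have : 0 ≤ 8 * sigC κ γ * B0 κ * A * (1 + r + t) ^ (-κ - γ) := by positivity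
          refine mul_le_mul_of_nonneg_left ?_ hr.le
          linarith
    · intro τ hτ
      refine (hbd τ hτ).trans ?_
      gcongr
      have b0 : (1 + r + t) / 2 ≤ 1 + |r + t - 2 * τ| := by
        have := neg_abs_le (r + t - 2 * τ)
        linarith [hτ.1]
      calc (1 + |r + t - 2 * τ|) ^ (-(1 + κ)) ≤ (1 + |r + t - 2 * τ|) ^ (-1 : ℝ) :=
            Real.rpow_le_rpow_of_exponent_le (by linarith [abs_nonneg (r + t - 2 * τ)]) (by linarith)
        _ = (1 + |r + t - 2 * τ|)⁻¹ := Real.rpow_neg_one _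
        _ ≤ ((1 + r + t) / 2)⁻¹ := by gcongr
        _ = 2 / (1 + r + t) := by rw [inv_div]
        _ ≤ 4 / (1 + r + t) := by gcongr; norm_num

def Th (e r t : ℝ) : ℝ := (1 + r + t) ^ (1 - e) * (1 + |r - t|)⁻¹

lemma Th_nonneg {e r t : ℝ} (hr : 0 ≤ r) (ht : 0 ≤ t) : 0 ≤ Th e r t := by
  unfold Th; positivity

lemma abs_sub_le_T {r t : ℝ} (hr : 0 ≤ r) (ht : 0 ≤ t) : 1 + |r - t| ≤ 1 + r + t := by
  have : |r - t| ≤ r + t := by rw [abs_le]; constructor <;> linarith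
  linarith

lemma Th_of_T {e r t : ℝ} (hr : 0 ≤ r) (ht : 0 ≤ t) : (1 + r + t) ^ (-e) ≤ Th e r t := by
  have hT : 0 < 1 + r + t := by linarith
  rw [Th, show 1 - e = -e + 1 by ring, Real.rpow_add hT, Real.rpow_one, mul_assoc]
  refine le_mul_of_one_le_right (by positivity) ?_
  rw [← div_eq_mul_inv, one_le_div (by positivity)]
  exact abs_sub_le_T hr ht

lemma Th_of_J {e κ r t : ℝ} (hκ : 0 ≤ κ) (hr : 0 ≤ r) (ht : 0 ≤ t) :
    (1 + |r - t|) ^ (-(1 + κ)) * (1 + r + t) ^ (1 - e) ≤ Th e r t := by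
  have hT : 0 < 1 + r + t := by linarith
  rw [Th, mul_comm]
  gcongr
  rw [← Real.rpow_neg_one]
  exact Real.rpow_le_rpow_of_exponent_le (by linarith [abs_nonneg (r - t)]) (by linarith)

lemma Th_of_H {κ γ r t : ℝ} (hκ : 0 < κ) (hκ1 : κ < 1) (hγ : 0 < γ) (hr : 0 ≤ r) (ht : 0 ≤ t) :
    (1 + r) ^ (-κ) * (1 + |r - t|) ^ (-(1 + κ)) * (1 + r + t) ^ (-γ) ≤ 2 * Th (κ + γ) r t := by
  have hT : 1 ≤ 1 + r + t := by linarith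
  have hT0 : 0 < 1 + r + t := by linarith
  have hx := abs_nonneg (r - t)
  have h1 : (1 + r + t) / 2 ≤ (1 + r) * (1 + |r - t|) := by
    have := neg_abs_le (r - t)
    nlinarith
  have h2 : (1 + r) ^ (-κ) * (1 + |r - t|) ^ (-κ) ≤ 2 * (1 + r + t) ^ (-κ) := by
    rw [← Real.mul_rpow (by linarith) (by linarith)]
    calc _ ≤ ((1 + r + t) / 2) ^ (-κ) := rpow_anti (by linarith) h1 hκ.le
      _ = (1 + r + t) ^ (-κ) * 2 ^ κ := by
          rw [Real.div_rpow hT0.le (by norm_num), Real.rpow_neg (by norm_num : (0:ℝ) ≤ 2), div_inv_eq_mul]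
      _ ≤ (1 + r + t) ^ (-κ) * 2 ^ (1:ℝ) := by
          gcongr
          norm_num
      _ = _ := by rw [Real.rpow_one]; ring
  have e1 : (1 + |r - t|) ^ (-(1 + κ)) = (1 + |r - t|) ^ (-κ) * (1 + |r - t|)⁻¹ := by
    rw [← Real.rpow_neg_one (1 + |r - t|), ← Real.rpow_add (by linarith)]; congr 1; ring
  have e2 : (1 + r + t) ^ (-κ) * (1 + r + t) ^ (-γ) ≤ (1 + r + t) ^ (1 - (κ + γ)) := by
    rw [← Real.rpow_add hT0]
    exact Real.rpow_le_rpow_of_exponent_le hT (by linarith)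
  calc _ = ((1 + r) ^ (-κ) * (1 + |r - t|) ^ (-κ)) * ((1 + |r - t|)⁻¹ * (1 + r + t) ^ (-γ)) := by
        rw [e1]; ring
    _ ≤ (2 * (1 + r + t) ^ (-κ)) * ((1 + |r - t|)⁻¹ * (1 + r + t) ^ (-γ)) := by gcongr
    _ = 2 * ((1 + r + t) ^ (-κ) * (1 + r + t) ^ (-γ)) * (1 + |r - t|)⁻¹ := by ring
    _ ≤ 2 * ((1 + r + t) ^ (1 - (κ + γ))) * (1 + |r - t|)⁻¹ := by gcongr
    _ = _ := by rw [Th]; ring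

lemma Th_small {e ρ r t : ℝ} (he : 1 < e) (hρ : 0 < ρ) (hρr : ρ ≤ r) (hr1 : r ≤ 1) (ht : 0 ≤ t) :
    Th e ρ t ≤ 2 ^ e * Th e r t := by
  have hT0 : 0 < 1 + r + t := by linarith
  have h1 : (1 + ρ + t) ^ (1 - e) ≤ 2 ^ (e - 1) * (1 + r + t) ^ (1 - e) := by
    calc (1 + ρ + t) ^ (1 - e) ≤ ((1 + r + t) / 2) ^ (1 - e) :=
          Real.rpow_le_rpow_of_nonpos (by linarith) (by linarith) (by linarith)
      _ = _ := by
        rw [Real.div_rpow hT0.le (by norm_num), show 1 - e = -(e - 1) by ring,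
          Real.rpow_neg (by norm_num : (0:ℝ) ≤ 2), div_inv_eq_mul, mul_comm]
  have h2 : (1 + |ρ - t|)⁻¹ ≤ 2 * (1 + |r - t|)⁻¹ := by
    have h3 : 1 + |r - t| ≤ 2 * (1 + |ρ - t|) := by
      have : |r - t| ≤ |r - ρ| + |ρ - t| := abs_sub_le _ _ _
      have h4 : |r - ρ| ≤ 1 := by rw [abs_le]; constructor <;> linarith
      linarith [abs_nonneg (ρ - t)]
    rw [← div_eq_mul_inv, inv_eq_one_div, div_le_div_iff₀ (by positivity) (by positivity)]
    linarith
  have e2 : (2:ℝ) ^ e = 2 ^ (e - 1) * 2 := by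
    rw [Real.rpow_sub_one (by norm_num)]; ring
  calc Th e ρ t ≤ (2 ^ (e - 1) * (1 + r + t) ^ (1 - e)) * (2 * (1 + |r - t|)⁻¹) := by
        unfold Th; gcongr
    _ = _ := by rw [e2, Th]; ring

/-- first-order mean value bound -/
lemma mvt_bound {f f' : ℝ → ℝ} {r B : ℝ} (hr : 0 ≤ r) (hf : ∀ x, HasDerivAt f (f' x) x)
    (hB : ∀ x, 0 < x → x ≤ r → |f' x| ≤ B) : |f r - f 0| ≤ B * r := by
  have := norm_sub_le_integral_of_norm_deriv_le_of_le (f := f) (B := fun _ => B) hr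
    (fun x _ => (hf x).continuousAt.continuousWithinAt)
    (fun x _ => (hf x).differentiableAt.differentiableWithinAt)
    (Eventually.of_forall fun x hx => by rw [(hf x).deriv]; exact hB x hx.1 hx.2.le)
    (continuous_const.intervalIntegrable _ _)
  rw [intervalIntegral.integral_const, smul_eq_mul, sub_zero, mul_comm] at this
  exact this

/-! ### junk values of derivatives at the boundary -/

lemma junk_i {f g : ℝ → ℝ} {d : ℝ} (h : ∀ t, 0 ≤ t → f t = g t) (hg : HasDerivAt g d 0) :
    deriv f 0 = 0 ∨ deriv f 0 = d := by
  by_cases hd : DifferentiableAt ℝ f 0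
  · right
    have h1 : HasDerivWithinAt f (deriv f 0) (Set.Ici 0) 0 := hd.hasDerivAt.hasDerivWithinAt
    have h2 : HasDerivWithinAt f d (Set.Ici 0) 0 :=
      hg.hasDerivWithinAt.congr (fun x hx => h x hx) (h 0 le_rfl)
    exact (uniqueDiffWithinAt_Ici 0).eq_deriv _ h1 h2
  · left; exact deriv_zero_of_not_differentiableAt hd

lemma junk_pos {f g : ℝ → ℝ} {d t : ℝ} (ht : 0 < t) (h : ∀ t, 0 ≤ t → f t = g t)
    (hg : HasDerivAt g d t) : deriv f t = d := by
  have : f =ᶠ[nhds t] g := by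
    filter_upwards [Ioi_mem_nhds ht] with x hx using h x (le_of_lt hx)
  exact (hg.congr_of_eventuallyEq this).deriv

lemma junk_iii {h g : ℝ → ℝ} {d r : ℝ} (hg : HasDerivAt g d r)
    (hh : ∀ᶠ x in nhds r, h x = 0 ∨ h x = g x) : deriv h r = 0 ∨ deriv h r = d := by
  by_cases h0 : deriv h r = 0
  · left; exact h0
  · right
    have hd : DifferentiableAt ℝ h r := by
      by_contra hc
      exact h0 (deriv_zero_of_not_differentiableAt hc)
    have h1 : ∀ᶠ x in nhdsWithin r {r}ᶜ, h x ≠ 0 := hd.hasDerivAt.eventually_ne h0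
    have h2 : ∀ᶠ x in nhdsWithin r {r}ᶜ, h x = g x := by
      filter_upwards [h1, hh.filter_mono nhdsWithin_le_nhds] with x hx hx2
      exact hx2.resolve_left hx
    have h3 : h r = g r := by
      have t1 : Tendsto h (nhdsWithin r {r}ᶜ) (nhds (h r)) := hd.continuousAt.continuousWithinAt
      have t2 : Tendsto h (nhdsWithin r {r}ᶜ) (nhds (g r)) :=
        (hg.continuousAt.continuousWithinAt.tendsto).congr' (h2.mono fun x hx => hx.symm)
      exact tendsto_nhds_unique t1 t2
    have h4 : h =ᶠ[nhds r] g := by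
      rw [eventually_nhdsWithin_iff] at h2
      filter_upwards [h2] with x hx
      by_cases hxr : x = r
      · rw [hxr]; exact h3
      · exact hx hxr
    exact (hg.congr_of_eventuallyEq h4).deriv

lemma abs_le_of_or {x d : ℝ} (h : x = 0 ∨ x = d) : |x| ≤ |d| := by
  rcases h with h | h
  · rw [h, abs_zero]; exact abs_nonneg _
  · rw [h]

lemma junk_all {w Φ wr wt wrr wrt wtt : ℝ → ℝ → ℝ}
    (hw : ∀ r t, 0 ≤ t → w r t = Φ r t)
    (hr : ∀ r t, 0 < r → 0 ≤ t → HasDerivAt (fun r => Φ r t) (wr r t) r)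
    (ht : ∀ r t, 0 < r → 0 ≤ t → HasDerivAt (fun t => Φ r t) (wt r t) t)
    (hrr : ∀ r t, 0 < r → 0 ≤ t → HasDerivAt (fun r => wr r t) (wrr r t) r)
    (hrt : ∀ r t, 0 < r → 0 ≤ t → HasDerivAt (fun r => wt r t) (wrt r t) r)
    (htt : ∀ r t, 0 < r → 0 ≤ t → HasDerivAt (fun t => wt r t) (wtt r t) t)
    {r t : ℝ} (hr0 : 0 < r) (ht0 : 0 ≤ t) :
    pdr w r t = wr r t ∧ |pdt w r t| ≤ |wt r t| ∧ pdr (pdr w) r t = wrr r t ∧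
    |pdr (pdt w) r t| ≤ |wrt r t| ∧ |pdt (pdt w) r t| ≤ |wtt r t| := by
  have k1 : ∀ r, 0 < r → pdr w r t = wr r t := by
    intro r hr0
    have : (fun r => w r t) = fun r => Φ r t := by funext r; exact hw r t ht0
    rw [pdr, this]; exact (hr r t hr0 ht0).deriv
  have k2pos : ∀ r t, 0 < r → 0 < t → pdt w r t = wt r t := by
    intro r t hr0 ht0
    exact junk_pos (g := fun t => Φ r t) ht0 (fun t h => hw r t h) (ht r t hr0 ht0.le)
  have k2zero : ∀ r, 0 < r → pdt w r 0 = 0 ∨ pdt w r 0 = wt r 0 := by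
    intro r hr0
    exact junk_i (g := fun t => Φ r t) (fun t h => hw r t h) (ht r 0 hr0 le_rfl)
  have k2 : ∀ r, 0 < r → pdt w r t = 0 ∨ pdt w r t = wt r t := by
    intro r hr0
    rcases ht0.eq_or_lt with h | h
    · rw [← h]; exact k2zero r hr0
    · right; exact k2pos r t hr0 h
  refine ⟨k1 r hr0, abs_le_of_or (k2 r hr0), ?_, ?_, ?_⟩
  · have : (fun r => pdr w r t) =ᶠ[nhds r] fun r => wr r t := by
      filter_upwards [Ioi_mem_nhds hr0] with x hx using k1 x hx
    show deriv (fun r => pdr w r t) r = _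
    exact ((hrr r t hr0 ht0).congr_of_eventuallyEq this).deriv
  · apply abs_le_of_or
    show deriv (fun r => pdt w r t) r = 0 ∨ deriv (fun r => pdt w r t) r = _
    refine junk_iii (hrt r t hr0 ht0) ?_
    filter_upwards [Ioi_mem_nhds hr0] with x hx using k2 x hx
  · apply abs_le_of_or
    show deriv (fun t => pdt w r t) t = 0 ∨ deriv (fun t => pdt w r t) t = _
    rcases ht0.eq_or_lt with h | h
    · subst h
      by_cases hd : DifferentiableAt ℝ (fun t => pdt w r t) 0
      · have hz : pdt w r 0 = wt r 0 := by
          have t1 : Tendsto (fun t => pdt w r t) (nhdsWithin 0 (Set.Ioi 0)) (nhds (pdt w r 0)) :=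
            hd.continuousAt.continuousWithinAt
          have t2 : Tendsto (fun t => pdt w r t) (nhdsWithin 0 (Set.Ioi 0)) (nhds (wt r 0)) := by
            refine Tendsto.congr' ?_ ((htt r 0 hr0 le_rfl).continuousAt.continuousWithinAt (s := Set.Ioi 0)).tendsto
            filter_upwards [self_mem_nhdsWithin] with x hx using (k2pos r x hr0 hx).symm
          exact tendsto_nhds_unique t1 t2
        refine junk_i (g := fun t => wt r t) ?_ (htt r 0 hr0 le_rfl)
        intro t h
        rcases h.eq_or_lt with h | h
        · rw [← h]; exact hz
        · exact k2pos r t hr0 h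
      · left; exact deriv_zero_of_not_differentiableAt hd
    · right
      have : (fun t => pdt w r t) =ᶠ[nhds t] fun t => wt r t := by
        filter_upwards [Ioi_mem_nhds h] with x hx using k2pos r x hr0 hx
      exact ((htt r t hr0 ht0).congr_of_eventuallyEq this).deriv

def KC (κ γ : ℝ) : ℝ := sigC κ γ + CJ κ γ + CI κ γ + 2

def DC (κ γ : ℝ) : ℝ := 2 * 2 ^ (κ + γ) * KC κ γ + 3 * KC κ γ

def FC (κ γ : ℝ) : ℝ := 5 * KC κ γ + 5 * DC κ γ

lemma KC_pos {κ γ : ℝ} (hκ1 : κ < 1) : 0 < KC κ γ ∧ sigC κ γ ≤ KC κ γ ∧ CJ κ γ ≤ KC κ γ ∧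
    CI κ γ ≤ KC κ γ ∧ 2 ≤ KC κ γ := by
  have h1 := sigC_nonneg κ γ
  have h2 := B0_nonneg κ
  have h5 : 0 < 1 - κ := by linarith
  have h3 : 0 ≤ CJ κ γ := by unfold CJ; positivity
  have h4 : 0 ≤ CI κ γ := by unfold CI; positivity
  unfold KC
  refine ⟨?_, ?_, ?_, ?_, ?_⟩ <;> linarith

lemma FC_pos {κ γ : ℝ} (hκ1 : κ < 1) : 0 < FC κ γ ∧ 3 * KC κ γ ≤ FC κ γ := by
  have := (KC_pos (γ := γ) hκ1).1
  have h2 : 0 < DC κ γ := by unfold DC; positivity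
  unfold FC
  constructor <;> linarith

set_option maxHeartbeats 1600000 in
theorem core {κ γ A₁ A₂ : ℝ} (hκ : 0 < κ) (hκ1 : κ < 1) (hγ : 0 < γ) (he : 1 < κ + γ)
    (hA₁ : 0 ≤ A₁) (hA : A₁ ≤ A₂) {H H' : ℝ → ℝ → ℝ}
    (hHc : Continuous (Function.uncurry H)) (hH'c : Continuous (Function.uncurry H'))
    (hd : ∀ l s, HasDerivAt (fun l => H l s) (H' l s) l)
    (hodd : ∀ l s, H (-l) s = - H l s)
    (hq : Qual (κ + γ) H) (hq' : Qual (κ + γ) H')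
    (hW : ∀ l s, l ≠ 0 → 0 < s → |H l s| ≤
      A₁ * ((1 + |l|) ^ (-κ) * (1 + |(|l| - s)|) ^ (-(1 + κ)) * (1 + |l| + s) ^ (-γ)))
    (hW' : ∀ l s, l ≠ 0 → 0 < s → |H' l s| ≤ A₂ * Wt κ γ |l| s)
    {w : ℝ → ℝ → ℝ} (hw : ∀ r t, 0 ≤ t → w r t = 1 / (2 * r) * Iint H r t)
    {r t : ℝ} (hr : 0 < r) (ht : 0 ≤ t) :
    bracket1 w r t ≤ FC κ γ * A₁ * Th (κ + γ) r t ∧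
    bracket2 w r t ≤ FC κ γ * A₂ * Th (κ + γ) r t := by
  obtain ⟨hK0, hK1, hK2, hK3, hK4⟩ := KC_pos (γ := γ) hκ1
  have hA₂ : 0 ≤ A₂ := hA₁.trans hA
  have hW1 : ∀ l s, l ≠ 0 → 0 < s → |H l s| ≤ A₁ * Wt κ γ |l| s := by
    intro l s hl hs
    refine (hW l s hl hs).trans ?_
    have hl' : 0 < |l| := abs_pos.2 hl
    unfold Wt
    have := rpow_anti hl' (by linarith : |l| ≤ 1 + |l|) hκ.le
    gcongr
  have ee : ∀ r t : ℝ, (1 + r + t) ^ (-κ - γ) = (1 + r + t) ^ (-(κ + γ)) := by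
    intro r t; congr 1; ring
  have ee' : ∀ r t : ℝ, (1 + r + t) ^ (1 - κ - γ) = (1 + r + t) ^ (1 - (κ + γ)) := by
    intro r t; congr 1; ring
  have genJ : ∀ {h : ℝ → ℝ → ℝ} {A : ℝ}, 0 ≤ A → Continuous (Function.uncurry h) → Qual (κ + γ) h →
      (∀ l s, l ≠ 0 → 0 < s → |h l s| ≤ A * Wt κ γ |l| s) → ∀ r t, 0 < r → 0 ≤ t →
      |Jint h r t| ≤ KC κ γ * A * Th (κ + γ) r t ∧ |Jint h (-r) t| ≤ KC κ γ * A * Th (κ + γ) r t := by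
    intro h A hA0 hc hqq hWW r t hr ht
    have t0 := Th_nonneg (e := κ + γ) hr.le ht
    constructor
    · refine (Jp_bound hκ hκ1 hγ he hA0 hWW hr ht).trans ?_
      rw [ee', mul_assoc]
      have := Th_of_J (e := κ + γ) hκ.le hr.le ht
      have h0 := sigC_nonneg κ γ
      gcongr
    · refine (Jm_bound hκ hκ1 hγ he hA0 he hc hqq hWW hr ht).trans ?_
      rw [ee]
      have := Th_of_T (e := κ + γ) hr.le ht
      have hT : 0 < 1 + r + t := by linarith
      gcongr
  have bJ := genJ hA₁ hHc hq hW1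
  have bJ' := genJ hA₂ hH'c hq' hW'
  have bI : ∀ r t, 0 < r → 0 ≤ t → |Iint H r t| ≤ r * (KC κ γ * A₁ * Th (κ + γ) r t) := by
    intro r t hr ht
    refine (I_bound hκ hκ1 hγ he hA₁ he hHc hq hodd hW1 hr ht).trans ?_
    rw [ee]
    have := Th_of_T (e := κ + γ) hr.le ht
    have hT : 0 < 1 + r + t := by linarith
    gcongr
  have bH : |H r t| ≤ KC κ γ * A₁ * Th (κ + γ) r t := by
    have hb : |H r t| ≤ A₁ * ((1 + r) ^ (-κ) * (1 + |r - t|) ^ (-(1 + κ)) * (1 + r + t) ^ (-γ)) := by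
      have c1 : Tendsto (fun s => |H r s|) (nhdsWithin t (Set.Ioi t)) (nhds |H r t|) := by
        have : Continuous (fun s => |H r s|) :=
          (hHc.comp (by fun_prop : Continuous fun s : ℝ => (r, s))).abs
        exact this.continuousWithinAt
      have c2 : Tendsto (fun s => A₁ * ((1 + r) ^ (-κ) * (1 + |r - s|) ^ (-(1 + κ)) * (1 + r + s) ^ (-γ)))
          (nhdsWithin t (Set.Ioi t))
          (nhds (A₁ * ((1 + r) ^ (-κ) * (1 + |r - t|) ^ (-(1 + κ)) * (1 + r + t) ^ (-γ)))) := by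
        have : ContinuousAt (fun s => A₁ * ((1 + r) ^ (-κ) * (1 + |r - s|) ^ (-(1 + κ)) * (1 + r + s) ^ (-γ))) t := by
          refine continuousAt_const.mul ((continuousAt_const.mul ?_).mul ?_)
          · refine ContinuousAt.rpow_const (by fun_prop) (Or.inl ?_)
            positivity
          · refine ContinuousAt.rpow_const (by fun_prop) (Or.inl ?_)
            positivity
        exact this.continuousWithinAt
      refine le_of_tendsto_of_tendsto c1 c2 ?_
      filter_upwards [self_mem_nhdsWithin] with s hs
      have := hW r s hr.ne' (ht.trans_lt hs)
      rwa [abs_of_pos hr] at this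
    have := Th_of_H hκ hκ1 hγ hr.le ht
    have t0 := Th_nonneg (e := κ + γ) hr.le ht
    calc _ ≤ A₁ * (2 * Th (κ + γ) r t) := hb.trans (by gcongr)
      _ = 2 * A₁ * Th (κ + γ) r t := by ring
      _ ≤ _ := by gcongr
  -- the formulas
  set Φ : ℝ → ℝ → ℝ := fun r t => 1 / (2 * r) * Iint H r t with hΦ
  set wr : ℝ → ℝ → ℝ := fun r t => (Jint H r t + Jint H (-r) t) / (2 * r) - Iint H r t / (2 * r ^ 2) with hwr
  set wt : ℝ → ℝ → ℝ := fun r t => (Jint H (-r) t - Jint H r t) / (2 * r) with hwt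
  set wrr : ℝ → ℝ → ℝ := fun r t => ((Jint H' r t - Jint H' (-r) t) / 2 - 2 * wr r t) / r with hwrr
  set wrt : ℝ → ℝ → ℝ := fun r t => ((-Jint H' r t - Jint H' (-r) t) / 2 - wt r t) / r with hwrt
  set wtt : ℝ → ℝ → ℝ := fun r t => (2 * H r t + Jint H' r t - Jint H' (-r) t) / (2 * r) with hwtt
  have dI : ∀ r t, 0 ≤ t → HasDerivAt (fun r => Iint H r t) (Jint H r t + Jint H (-r) t) r :=
    fun r t ht => Iint_r he hHc hq ht
  have dIt : ∀ r t, 0 ≤ t → HasDerivAt (fun t => Iint H r t) (Jint H (-r) t - Jint H r t) t :=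
    fun r t ht => Iint_t he hHc hodd hq ht
  have dJ : ∀ r t, 0 ≤ t → HasDerivAt (fun r => Jint H r t) (Jint H' r t) r :=
    fun r t ht => Jint_x he hHc hH'c hd hq hq' ht
  have dJm : ∀ r t, 0 ≤ t → HasDerivAt (fun r => Jint H (-r) t) (-Jint H' (-r) t) r := by
    intro r t ht
    have := (dJ (-r) t ht).comp r (hasDerivAt_neg r)
    convert! this using 1
    ring
  have dJt : ∀ x t, 0 ≤ t → HasDerivAt (fun t => Jint H x t) (-(Jint H' x t) - H x t) t :=
    fun x t ht => Jint_t he hHc hH'c hd hq hq' ht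
  have J := junk_all (w := w) (Φ := Φ) (wr := wr) (wt := wt) (wrr := wrr) (wrt := wrt) (wtt := wtt)
    hw ?_ ?_ ?_ ?_ ?_ hr ht
  rotate_left
  · intro r t hr ht
    have h1 : HasDerivAt (fun r : ℝ => 1 / (2 * r)) (-(1 / (2 * r ^ 2))) r := by
      have := ((hasDerivAt_id r).const_mul 2).inv (by simpa using hr.ne')
      convert! this using 1
      · funext x; simp
      · simp; field_simp
    have := h1.mul (dI r t ht)
    convert! this using 1
    simp only [hwr]; field_simp; ring
  · intro r t hr ht
    have := (dIt r t ht).const_mul (1 / (2 * r))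
    convert! this using 1
    simp only [hwt]; field_simp
  · intro r t hr ht
    have h1 := ((dJ r t ht).add (dJm r t ht)).div ((hasDerivAt_id r).const_mul 2) (by simpa using hr.ne')
    have h2 := (dI r t ht).div (((hasDerivAt_id r).pow 2).const_mul 2) (by simpa using hr.ne')
    have := h1.sub h2
    convert! this using 1
    simp only [hwrr, hwr, id, Pi.add_apply, Pi.pow_apply]; field_simp; ring
  · intro r t hr ht
    have h1 := ((dJm r t ht).sub (dJ r t ht)).div ((hasDerivAt_id r).const_mul 2) (by simpa using hr.ne')
    convert! h1 using 1
    simp only [hwrt, hwt, id, Pi.sub_apply]; field_simp; ring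
  · intro r t hr ht
    have h1 := ((dJt (-r) t ht).sub (dJt r t ht)).div_const (2 * r)
    convert! h1 using 1
    simp only [hwtt, hodd]; congr 1; ring
  obtain ⟨j1, j2, j3, j4, j5⟩ := J
  set Θ := Th (κ + γ) r t with hΘ
  have t0 : 0 ≤ Θ := Th_nonneg (e := κ + γ) hr.le ht
  set B := KC κ γ * A₁ * Θ with hB
  set B' := KC κ γ * A₂ * Θ with hB'
  have hBB : B ≤ B' := by simp only [hB, hB']; gcongr
  have hB0 : 0 ≤ B := by positivity
  obtain ⟨x1, x2⟩ := bJ r t hr ht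
  obtain ⟨y1, y2⟩ := bJ' r t hr ht
  have x3 := bI r t hr ht
  rw [← hΘ, ← hB] at x1 x2 x3
  rw [← hΘ, ← hB'] at y1 y2
  have fw : |w r t| ≤ B / 2 := by
    rw [hw r t ht, abs_mul, abs_of_pos (by positivity : 0 < 1 / (2 * r))]
    rw [div_mul_eq_mul_div, one_mul, div_le_iff₀ (by positivity)]
    linarith
  have fwr : r * |wr r t| ≤ 3 / 2 * B := by
    have e1 : r * wr r t = (Jint H r t + Jint H (-r) t) / 2 - Φ r t := by
      simp only [hwr, hΦ]; field_simp
    have e2 : |Φ r t| ≤ B / 2 := by have := fw; rw [hw r t ht] at this; exact this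
    rw [← abs_of_pos hr, ← abs_mul, abs_of_pos hr, e1]
    rw [abs_le] at x1 x2 e2 ⊢
    constructor <;> linarith
  have fwt : r * |wt r t| ≤ B := by
    have e1 : r * wt r t = (Jint H (-r) t - Jint H r t) / 2 := by
      simp only [hwt]; field_simp
    rw [← abs_of_pos hr, ← abs_mul, abs_of_pos hr, e1]
    rw [abs_le] at x1 x2 ⊢
    constructor <;> linarith
  have n1 := abs_nonneg (wr r t)
  have n2 := abs_nonneg (wt r t)
  obtain ⟨hF0, hF3⟩ := FC_pos (γ := γ) hκ1
  constructor
  · unfold bracket1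
    rw [j1]
    calc _ ≤ B / 2 + (3 / 2 * B + B) := by
          have : r * |pdt w r t| ≤ r * |wt r t| := by gcongr
          rw [mul_add]
          linarith
      _ = 3 * KC κ γ * A₁ * Θ := by rw [hB]; ring
      _ ≤ _ := by gcongr
  · -- bounds with factor 1 + r
    have hD : (1 + r) * |wr r t| ≤ DC κ γ * A₂ * Θ ∧ (1 + r) * |wt r t| ≤ DC κ γ * A₂ * Θ := by
      have eD : DC κ γ * A₂ * Θ = 2 * (2 ^ (κ + γ) * B') + 3 * B' := by rw [DC, hB']; ring
      have hcB : 0 ≤ 2 ^ (κ + γ) * B' := by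
        have : 0 ≤ B' := hB0.trans hBB
        positivity
      rw [eD]
      rcases le_or_gt 1 r with h1 | h1
      · have v1 := mul_le_mul_of_nonneg_right (by linarith : 1 + r ≤ 2 * r) n1
        have v2 := mul_le_mul_of_nonneg_right (by linarith : 1 + r ≤ 2 * r) n2
        constructor <;> linarith
      · have small : ∀ ρ, 0 < ρ → ρ ≤ r → KC κ γ * A₂ * Th (κ + γ) ρ t ≤ 2 ^ (κ + γ) * B' := by
          intro ρ h0 hρ
          have := Th_small he h0 hρ h1.le ht
          calc _ ≤ KC κ γ * A₂ * (2 ^ (κ + γ) * Th (κ + γ) r t) := by gcongr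
            _ = _ := by rw [hB']; ring
        have q1 : |wr r t| ≤ 2 ^ (κ + γ) * B' := by
          have hg : ∀ x, HasDerivAt (fun ρ => ρ * (Jint H ρ t + Jint H (-ρ) t) - Iint H ρ t)
              (x * (Jint H' x t - Jint H' (-x) t)) x := by
            intro x
            have := ((hasDerivAt_id x).mul ((dJ x t ht).add (dJm x t ht))).sub (dI x t ht)
            convert! this using 1
            simp only [Pi.add_apply, id]; ring
          have := mvt_bound hr.le hg (B := r * (2 * (2 ^ (κ + γ) * B'))) ?_
          · simp only [zero_mul, Iint_zero, sub_zero] at this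
            have e1 : r * (Jint H r t + Jint H (-r) t) - Iint H r t = 2 * r ^ 2 * wr r t := by
              simp only [hwr]; field_simp
            rw [e1, abs_mul, abs_of_pos (by positivity)] at this
            have h2 : 0 < 2 * r ^ 2 := by positivity
            refine le_of_mul_le_mul_left (this.trans (le_of_eq ?_)) h2
            ring
          · intro x hx hxr
            obtain ⟨z1, z2⟩ := bJ' x t hx ht
            have z3 := small x hx hxr
            rw [abs_mul, abs_of_pos hx]
            gcongr
            refine (abs_sub _ _).trans ?_
            linarith
        have q2 : |wt r t| ≤ 2 ^ (κ + γ) * B' := by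
          have hg : ∀ x, HasDerivAt (fun ρ => Jint H (-ρ) t - Jint H ρ t)
              (-Jint H' (-x) t - Jint H' x t) x := fun x => (dJm x t ht).sub (dJ x t ht)
          have := mvt_bound hr.le hg (B := 2 * (2 ^ (κ + γ) * B')) ?_
          · simp only [neg_zero, sub_self, sub_zero] at this
            have e1 : Jint H (-r) t - Jint H r t = 2 * r * wt r t := by
              simp only [hwt]; field_simp
            rw [e1, abs_mul, abs_of_pos (by positivity)] at this
            have h2 : 0 < 2 * r := by positivity
            refine le_of_mul_le_mul_left (this.trans (le_of_eq ?_)) h2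
            ring
          · intro x hx hxr
            obtain ⟨z1, z2⟩ := bJ' x t hx ht
            have z3 := small x hx hxr
            refine (abs_sub _ _).trans ?_
            rw [abs_neg]
            linarith
        have v1 := mul_le_mul_of_nonneg_right (by linarith : 1 + r ≤ 2) n1
        have v2 := mul_le_mul_of_nonneg_right (by linarith : 1 + r ≤ 2) n2
        constructor <;> linarith
    obtain ⟨d1, d2⟩ := hD
    set D := DC κ γ * A₂ * Θ with hDdef
    have f1 : r * |wrr r t| ≤ B' + 2 * D := by
      have e1 : r * wrr r t = (Jint H' r t - Jint H' (-r) t) / 2 - 2 * wr r t := by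
        simp only [hwrr]; field_simp
      have e2 : |wr r t| ≤ D := (le_mul_of_one_le_left n1 (by linarith)).trans d1
      rw [← abs_of_pos hr, ← abs_mul, abs_of_pos hr, e1]
      rw [abs_le] at y1 y2 e2 ⊢
      constructor <;> linarith
    have f2 : r * |wrt r t| ≤ B' + D := by
      have e1 : r * wrt r t = (-Jint H' r t - Jint H' (-r) t) / 2 - wt r t := by
        simp only [hwrt]; field_simp
      have e2 : |wt r t| ≤ D := (le_mul_of_one_le_left n2 (by linarith)).trans d2
      rw [← abs_of_pos hr, ← abs_mul, abs_of_pos hr, e1]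
      rw [abs_le] at y1 y2 e2 ⊢
      constructor <;> linarith
    have f3 : r * |wtt r t| ≤ 2 * B' := by
      have e1 : r * wtt r t = H r t + (Jint H' r t - Jint H' (-r) t) / 2 := by
        simp only [hwtt]; field_simp; ring
      rw [← abs_of_pos hr, ← abs_mul, abs_of_pos hr, e1]
      rw [abs_le] at y1 y2 bH ⊢
      constructor <;> linarith
    unfold bracket2
    rw [j1, j3]
    have g1 : (1 + r) * |pdt w r t| ≤ (1 + r) * |wt r t| := by gcongr
    have g2 : r * |pdr (pdt w) r t| ≤ r * |wrt r t| := by gcongr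
    have g3 : r * |pdt (pdt w) r t| ≤ r * |wtt r t| := by gcongr
    calc _ ≤ B' + (D + D) + ((B' + 2 * D) + (B' + D) + 2 * B') := by
          rw [mul_add, mul_add, mul_add]
          linarith
      _ = FC κ γ * A₂ * Θ := by rw [FC, hB', hDdef]; ring

lemma hasDerivAt_mul_self_zero {g : ℝ → ℝ} (hg : ContinuousAt g 0) :
    HasDerivAt (fun l => l * g l) (g 0) 0 := by
  rw [hasDerivAt_iff_tendsto_slope]
  have : Tendsto g (nhdsWithin 0 {0}ᶜ) (nhds (g 0)) := hg.continuousWithinAt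
  refine this.congr' ?_
  filter_upwards [self_mem_nhdsWithin] with x hx
  have hx' : x ≠ 0 := hx
  simp [slope_def_field, hx']

/-- regularity data attached to an element of the class -/
structure RegData (u v D : ℝ → ℝ → ℝ) : Prop where
  vc : Continuous (Function.uncurry v)
  Dc : Continuous (Function.uncurry D)
  hd : ∀ l s, HasDerivAt (fun l => l * v l s) (D l s) l
  ev : ∀ l s, v (-l) s = v l s
  pt : ∀ l s, 0 < s → HasDerivAt (fun s => u l s) (v l s) s

lemma exists_regData {u : ℝ → ℝ → ℝ} (hu : memX 2 u) : ∃ v D, RegData u v D := by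
  obtain ⟨h1, h2, hev⟩ := hu
  have h1 : ContDiffOn ℝ 1 (fun z : ℝ × ℝ => u z.1 z.2) (Set.univ ×ˢ Set.Ici (0:ℝ)) := h1
  have h2 : ContDiffOn ℝ 2 (fun z : ℝ × ℝ => z.1 * u z.1 z.2) (Set.univ ×ˢ Set.Ici (0:ℝ)) := h2
  set S : Set (ℝ × ℝ) := Set.univ ×ˢ Set.Ici (0:ℝ) with hS
  set U : ℝ × ℝ → ℝ := fun z => u z.1 z.2 with hU
  have hSu : UniqueDiffOn ℝ S := uniqueDiffOn_univ.prod (uniqueDiffOn_Ici 0)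
  have hmem : ∀ l s : ℝ, (l, max s 0) ∈ S := fun l s => ⟨trivial, le_max_right s 0⟩
  have hproj : Continuous (fun z : ℝ × ℝ => (z.1, max z.2 0)) := by fun_prop
  set m : ℝ × ℝ → ℝ := fun z => fderivWithin ℝ (fun z : ℝ × ℝ => z.1 * u z.1 z.2) S z (0, 1) with hm
  have hmC : ContDiffOn ℝ 1 m S := by
    have := h2.fderivWithin (m := 1) hSu (by norm_num)
    exact this.clm_apply contDiffOn_const
  have hdU : ∀ z ∈ S, HasFDerivWithinAt U (fderivWithin ℝ U S z) S z := fun z hz =>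
    (h1.differentiableOn (by norm_num) z hz).hasFDerivWithinAt
  have hmz : ∀ z ∈ S, m z = z.1 * fderivWithin ℝ U S z (0, 1) := by
    intro z hz
    have e1 : HasFDerivWithinAt (fun z : ℝ × ℝ => z.1) (ContinuousLinearMap.fst ℝ ℝ ℝ) S z :=
      hasFDerivWithinAt_fst
    have e2 := (e1.mul (hdU z hz)).fderivWithin (hSu z hz)
    have e3 : m z = fderivWithin ℝ ((fun z : ℝ × ℝ => z.1) * U) S z (0, 1) := rfl
    rw [e3, e2]
    simp
  have hwithin : ∀ l s, 0 ≤ s → HasDerivWithinAt (fun s => u l s) (fderivWithin ℝ U S (l, s) (0, 1)) (Set.Ici 0) s := by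
    intro l s hs
    have k := hdU (l, s) ⟨trivial, hs⟩
    have k2 : HasDerivWithinAt (fun s : ℝ => (l, s)) ((0:ℝ), (1:ℝ)) (Set.Ici 0) s :=
      ((hasDerivAt_const s l).prodMk (hasDerivAt_id s)).hasDerivWithinAt
    exact k.comp_hasDerivWithinAt s k2 (fun x hx => ⟨trivial, hx⟩)
  refine ⟨fun l s => fderivWithin ℝ U S (l, max s 0) (0, 1),
    fun l s => fderivWithin ℝ m S (l, max s 0) (1, 0), ⟨?_, ?_, ?_, ?_, ?_⟩⟩
  · have := (h1.continuousOn_fderivWithin hSu le_rfl).comp_continuous hproj (fun z => hmem z.1 z.2)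
    exact this.clm_apply continuous_const
  · have := (hmC.continuousOn_fderivWithin hSu le_rfl).comp_continuous hproj (fun z => hmem z.1 z.2)
    exact this.clm_apply continuous_const
  · intro l s
    have k := (hmC.differentiableOn (by norm_num) _ (hmem l s)).hasFDerivWithinAt
    have k2 : HasDerivWithinAt (fun l : ℝ => (l, max s 0)) ((1:ℝ), (0:ℝ)) Set.univ l :=
      ((hasDerivAt_id l).prodMk (hasDerivAt_const l (max s 0))).hasDerivWithinAt
    have := k.comp_hasDerivWithinAt l k2 (fun x _ => hmem x s)
    rw [hasDerivWithinAt_univ] at this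
    refine this.congr_of_eventuallyEq (Eventually.of_forall fun x => ?_)
    exact (hmz _ (hmem x s)).symm
  · intro l s
    have k1 := hwithin (-l) (max s 0) (le_max_right _ _)
    have k2 := hwithin l (max s 0) (le_max_right _ _)
    have k3 := k2.congr (f₁ := fun s => u (-l) s) (fun x hx => hev l x hx) (hev l _ (le_max_right _ _))
    exact (uniqueDiffOn_Ici (0:ℝ) _ (le_max_right s 0)).eq_deriv _ k1 k3
  · intro l s hs
    have := (hwithin l s hs.le).hasDerivAt (Ici_mem_nhds hs)
    rwa [max_eq_left hs.le]

namespace RegData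
variable {u v D : ℝ → ℝ → ℝ}

lemma pdt_eq (R : RegData u v D) (l : ℝ) {s : ℝ} (hs : 0 < s) : pdt u l s = v l s := (R.pt l s hs).deriv

lemma vl (R : RegData u v D) {l : ℝ} (hl : l ≠ 0) (s : ℝ) :
    HasDerivAt (fun l => v l s) ((D l s - v l s) / l) l := by
  have h := (R.hd l s).div (hasDerivAt_id l) hl
  have e : ((fun l => l * v l s) / id) =ᶠ[nhds l] fun l => v l s := by
    filter_upwards [isOpen_ne.mem_nhds hl] with x hx
    have hx' : x ≠ 0 := hx
    simp [hx']
  have h2 := h.congr_of_eventuallyEq e.symm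
  convert! h2 using 1
  show _ = (D l s * l - l * v l s * 1) / l ^ 2
  field_simp

lemma pdr_pdt (R : RegData u v D) {l : ℝ} (hl : l ≠ 0) {s : ℝ} (hs : 0 < s) :
    pdr (pdt u) l s = (D l s - v l s) / l := by
  have : (fun r => pdt u r s) = fun r => v r s := by
    funext r; exact R.pdt_eq r hs
  rw [pdr, this]
  exact (R.vl hl s).deriv

lemma vcl (R : RegData u v D) (s : ℝ) : Continuous (fun l => v l s) :=
  R.vc.comp (by fun_prop : Continuous fun l : ℝ => (l, s))

lemma D_zero (R : RegData u v D) (s : ℝ) : D 0 s = v 0 s :=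
  (R.hd 0 s).unique (hasDerivAt_mul_self_zero (g := fun l => v l s) (R.vcl s).continuousAt)

lemma D_even (R : RegData u v D) (l s : ℝ) : D (-l) s = D l s := by
  have h1 := (R.hd (-l) s).comp l (hasDerivAt_neg l)
  have h2 : HasDerivAt (fun l => l * v l s) (D (-l) s) l := by
    have := h1.neg
    convert! this using 1
    · funext x
      simp [R.ev]
    · ring
  exact h2.unique (R.hd l s)

lemma sub {u' v' D' : ℝ → ℝ → ℝ} (R : RegData u v D) (R' : RegData u' v' D') :
    RegData (u - u') (v - v') (D - D') where
  vc := R.vc.sub R'.vc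
  Dc := R.Dc.sub R'.Dc
  hd l s := by
    have := (R.hd l s).sub (R'.hd l s)
    convert! this using 1
    funext x
    simp [mul_sub]
  ev l s := by simp [R.ev, R'.ev]
  pt l s hs := (R.pt l s hs).sub (R'.pt l s hs)

end RegData

/-! ### the power nonlinearity -/

def phi (p x : ℝ) : ℝ := |x| ^ (p - 2) * x

lemma abs_phi {p x : ℝ} (hp : 1 < p) : |phi p x| = |x| ^ (p - 1) := by
  rw [phi, abs_mul, abs_of_nonneg (by positivity)]
  rcases eq_or_ne x 0 with h | h
  · subst h
    simp [Real.zero_rpow (by linarith : p - 1 ≠ 0)]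
  · have : 0 < |x| := abs_pos.2 h
    rw [show p - 1 = (p - 2) + 1 by ring, Real.rpow_add this, Real.rpow_one]

lemma phi_of_nonneg {p x : ℝ} (hp : 1 < p) (hx : 0 ≤ x) : phi p x = x ^ (p - 1) := by
  have := abs_phi (x := x) hp
  rw [abs_of_nonneg hx] at this
  rwa [abs_of_nonneg (by unfold phi; positivity)] at this

lemma phi_neg (p x : ℝ) : phi p (-x) = - phi p x := by
  simp [phi]

lemma phi_holder {p : ℝ} (hp : 1 < p) (hp2 : p < 2) (x y : ℝ) :
    |phi p x - phi p y| ≤ 2 * |x - y| ^ (p - 1) := by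
  have hk : 0 ≤ p - 1 := by linarith
  have hk1 : p - 1 ≤ 1 := by linarith
  have key : ∀ a b : ℝ, 0 ≤ a → a ≤ b → |b ^ (p - 1) - a ^ (p - 1)| ≤ |b - a| ^ (p - 1) := by
    intro a b ha hab
    have h1 := Real.rpow_add_le_add_rpow ha (by linarith : 0 ≤ b - a) hk hk1
    rw [show a + (b - a) = b by ring] at h1
    have h2 : a ^ (p - 1) ≤ b ^ (p - 1) := by gcongr
    rw [abs_of_nonneg (by linarith), abs_of_nonneg (by linarith)]
    linarith
  have pos2 : ∀ a b : ℝ, 0 ≤ a → 0 ≤ b → |phi p a - phi p b| ≤ 2 * |a - b| ^ (p - 1) := by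
    intro a b ha hb
    rw [phi_of_nonneg hp ha, phi_of_nonneg hp hb]
    have n : 0 ≤ |a - b| ^ (p - 1) := by positivity
    rcases le_total a b with h | h
    · have := key a b ha h
      rw [abs_sub_comm (a ^ (p - 1))]
      rw [abs_sub_comm b a] at this
      linarith
    · have := key b a hb h
      linarith
  have mix : ∀ a b : ℝ, 0 ≤ a → b ≤ 0 → |phi p a - phi p b| ≤ 2 * |a - b| ^ (p - 1) := by
    intro a b ha hb
    have e1 : phi p b = - (-b) ^ (p - 1) := by
      rw [← phi_of_nonneg hp (by linarith : 0 ≤ -b), phi_neg, neg_neg]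
    rw [phi_of_nonneg hp ha, e1, sub_neg_eq_add]
    have a1 : a ^ (p - 1) ≤ |a - b| ^ (p - 1) := by
      gcongr; rw [abs_of_nonneg (by linarith)]; linarith
    have a2 : (-b) ^ (p - 1) ≤ |a - b| ^ (p - 1) := by
      have : 0 ≤ -b := by linarith
      gcongr; rw [abs_of_nonneg (by linarith)]; linarith
    have : 0 ≤ -b := by linarith
    rw [abs_of_nonneg (by positivity)]
    linarith
  rcases le_total 0 x with hx | hx <;> rcases le_total 0 y with hy | hy
  · exact pos2 x y hx hy
  · exact mix x y hx hy
  · rw [abs_sub_comm, abs_sub_comm x]; exact mix y x hy hx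
  · have := pos2 (-x) (-y) (by linarith) (by linarith)
    rw [phi_neg, phi_neg] at this
    rw [show -phi p x - -phi p y = -(phi p x - phi p y) by ring, abs_neg,
      show -x - -y = -(x - y) by ring, abs_neg] at this
    exact this

lemma phi_cont {p : ℝ} (hp : 1 < p) (hp2 : p < 2) : Continuous (phi p) := by
  rw [continuous_iff_continuousAt]
  intro x
  rw [ContinuousAt, tendsto_iff_dist_tendsto_zero]
  refine squeeze_zero (fun y => dist_nonneg) (g := fun y => 2 * |y - x| ^ (p - 1))
    (fun y => by rw [Real.dist_eq]; exact phi_holder hp hp2 y x) ?_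
  have : Continuous (fun y => 2 * |y - x| ^ (p - 1)) := by
    refine continuous_const.mul (Continuous.rpow_const (by fun_prop) fun y => Or.inr (by linarith))
  have h := this.tendsto x
  simpa [Real.zero_rpow (by linarith : p - 1 ≠ 0)] using h

lemma hasDerivAt_absp {p : ℝ} (hp : 1 < p) (x : ℝ) :
    HasDerivAt (fun x : ℝ => |x| ^ p) (p * phi p x) x := by
  have := hasDerivAt_abs_rpow x hp
  rw [phi, ← mul_assoc]
  exact this

lemma absp_lip {p B x y : ℝ} (hp : 1 < p) (hx : |x| ≤ B) (hy : |y| ≤ B) :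
    |(|x| ^ p - |y| ^ p)| ≤ p * B ^ (p - 1) * |x - y| := by
  have := Convex.norm_image_sub_le_of_norm_hasDerivWithin_le (𝕜 := ℝ) (f := fun x : ℝ => |x| ^ p)
    (f' := fun x => p * phi p x) (s := Set.Icc (-B) B) (C := p * B ^ (p - 1)) (x := y) (y := x)
    (fun x _ => (hasDerivAt_absp hp x).hasDerivWithinAt) ?_ (convex_Icc _ _) (abs_le.1 hy) (abs_le.1 hx)
  · exact this
  · intro z hz
    rw [Real.norm_eq_abs, abs_mul, abs_phi hp, abs_of_pos (by linarith : 0 < p)]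
    have hz' : |z| ≤ B := abs_le.2 hz
    have : 0 ≤ p - 1 := by linarith
    gcongr

lemma ptw_H {p a K N l y z v v' : ℝ} (hp : 1 < p) (hp2 : p < 2) (ha : 1 < a) (hK : 0 ≤ K) (hN : 0 ≤ N)
    (hl : 0 < l) (hy : 1 ≤ y) (hz : 1 ≤ z)
    (hv : |v| ≤ K * (1 + l)⁻¹ * y⁻¹) (hv' : |v'| ≤ K * (1 + l)⁻¹ * y⁻¹)
    (hδ : |v - v'| ≤ N * l⁻¹ * z ^ (1 - a) * y⁻¹) :
    |l * (|v| ^ p - |v'| ^ p)| ≤ p * K ^ (p - 1) * N *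
      ((1 + l) ^ (-(p - 1)) * y ^ (-(1 + (p - 1))) * z ^ (-((p - 1) * (a - 1)))) := by
  have hy0 : 0 < y := by linarith
  have h1 := absp_lip hp hv hv'
  have hB : (K * (1 + l)⁻¹ * y⁻¹) ^ (p - 1) = K ^ (p - 1) * (1 + l) ^ (-(p - 1)) * y ^ (-(p - 1)) := by
    rw [Real.mul_rpow (by positivity) (by positivity), Real.mul_rpow hK (by positivity),
      Real.inv_rpow (by positivity), Real.inv_rpow (by positivity), Real.rpow_neg (by positivity),
      Real.rpow_neg (by positivity)]
  have hz1 : z ^ (1 - a) ≤ z ^ (-((p - 1) * (a - 1))) :=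
    Real.rpow_le_rpow_of_exponent_le hz (by nlinarith)
  have hy1 : y ^ (-(1 + (p - 1))) = y⁻¹ * y ^ (-(p - 1)) := by
    rw [show -(1 + (p - 1)) = -1 + -(p - 1) by ring, Real.rpow_add hy0, Real.rpow_neg_one]
  rw [abs_mul, abs_of_pos hl]
  rw [hB] at h1
  calc l * |(|v| ^ p - |v'| ^ p)|
      ≤ l * (p * (K ^ (p - 1) * (1 + l) ^ (-(p - 1)) * y ^ (-(p - 1))) * (N * l⁻¹ * z ^ (1 - a) * y⁻¹)) := by
        gcongr
        refine h1.trans ?_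
        gcongr
    _ = p * K ^ (p - 1) * N *
      ((1 + l) ^ (-(p - 1)) * y ^ (-(1 + (p - 1))) * z ^ (1 - a)) := by
        rw [hy1]; field_simp
    _ ≤ _ := by gcongr

lemma ptw_H' {p a K N N₂ l m y z v v' E E' : ℝ} (hp : 1 < p) (hp2 : p < 2) (ha : 1 < a) (hK : 0 ≤ K)
    (hN : 0 ≤ N) (hN₂ : 0 ≤ N₂) (hm : 0 < m) (hml : m ≤ 1 + l)
    (hl : 0 < l) (hy : 1 ≤ y) (hz : 1 ≤ z)
    (hv : |v| ≤ K * (1 + l)⁻¹ * y⁻¹) (hv' : |v'| ≤ K * (1 + l)⁻¹ * y⁻¹)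
    (hE' : |E'| ≤ K * y⁻¹)
    (hδ : |v - v'| ≤ N * m⁻¹ * z ^ (1 - a) * y⁻¹)
    (hδ2 : |v - v'| ≤ N₂ * (1 + l)⁻¹ * z ^ (1 - a) * y⁻¹)
    (hE : |E - E'| ≤ N₂ * z ^ (1 - a) * y⁻¹) :
    |(|v| ^ p - |v'| ^ p) + p * (phi p v * E - phi p v' * E')| ≤
      2 * p * (K ^ (p - 1) * N₂ + K * N ^ (p - 1)) *
      (m ^ (-(p - 1)) * y ^ (-(1 + (p - 1))) * z ^ (-((p - 1) * (a - 1)))) := by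
  have hy0 : 0 < y := by linarith
  have hz0 : 0 < z := by linarith
  have hk : 0 < p - 1 := by linarith
  have h1 := absp_lip hp hv hv'
  have hB : (K * (1 + l)⁻¹ * y⁻¹) ^ (p - 1) = K ^ (p - 1) * (1 + l) ^ (-(p - 1)) * y ^ (-(p - 1)) := by
    rw [Real.mul_rpow (by positivity) (by positivity), Real.mul_rpow hK (by positivity),
      Real.inv_rpow (by positivity), Real.inv_rpow (by positivity), Real.rpow_neg (by positivity),
      Real.rpow_neg (by positivity)]
  have hD : (N * m⁻¹ * z ^ (1 - a) * y⁻¹) ^ (p - 1) =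
      N ^ (p - 1) * m ^ (-(p - 1)) * z ^ (-((p - 1) * (a - 1))) * y ^ (-(p - 1)) := by
    rw [Real.mul_rpow (by positivity) (by positivity), Real.mul_rpow (by positivity) (by positivity),
      Real.mul_rpow hN (by positivity),
      Real.inv_rpow (by positivity), Real.inv_rpow (by positivity), Real.rpow_neg (by positivity),
      Real.rpow_neg hy0.le, ← Real.rpow_mul hz0.le, show (1 - a) * (p - 1) = -((p - 1) * (a - 1)) by ring]
  have hz1 : z ^ (1 - a) ≤ z ^ (-((p - 1) * (a - 1))) :=
    Real.rpow_le_rpow_of_exponent_le hz (by nlinarith)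
  have hy1 : y ^ (-(1 + (p - 1))) = y⁻¹ * y ^ (-(p - 1)) := by
    rw [show -(1 + (p - 1)) = -1 + -(p - 1) by ring, Real.rpow_add hy0, Real.rpow_neg_one]
  have hlm : (1 + l) ^ (-(p - 1)) ≤ m ^ (-(p - 1)) := rpow_anti hm hml hk.le
  have hl1 : (1 + l)⁻¹ ≤ 1 := inv_le_one_of_one_le₀ (by linarith)
  have hphi : |phi p v| ≤ K ^ (p - 1) * (1 + l) ^ (-(p - 1)) * y ^ (-(p - 1)) := by
    rw [abs_phi hp, ← hB]; gcongr
  have hphi2 : |phi p v - phi p v'| ≤ 2 * (N ^ (p - 1) * m ^ (-(p - 1)) * z ^ (-((p - 1) * (a - 1))) * y ^ (-(p - 1))) := by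
    refine (phi_holder hp hp2 v v').trans ?_
    rw [← hD]; gcongr
  rw [hB] at h1
  have T1 : |(|v| ^ p - |v'| ^ p)| ≤ p * K ^ (p - 1) * N₂ *
      (m ^ (-(p - 1)) * y ^ (-(1 + (p - 1))) * z ^ (-((p - 1) * (a - 1)))) := by
    calc |(|v| ^ p - |v'| ^ p)|
        ≤ p * (K ^ (p - 1) * (1 + l) ^ (-(p - 1)) * y ^ (-(p - 1))) * (N₂ * (1 + l)⁻¹ * z ^ (1 - a) * y⁻¹) := by
          refine h1.trans ?_
          gcongr
      _ ≤ p * (K ^ (p - 1) * m ^ (-(p - 1)) * y ^ (-(p - 1))) * (N₂ * 1 * z ^ (-((p - 1) * (a - 1))) * y⁻¹) := by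
          gcongr
      _ = _ := by rw [hy1]; ring
  have T2 : |phi p v * (E - E')| ≤ K ^ (p - 1) * N₂ *
      (m ^ (-(p - 1)) * y ^ (-(1 + (p - 1))) * z ^ (-((p - 1) * (a - 1)))) := by
    rw [abs_mul]
    calc _ ≤ (K ^ (p - 1) * (1 + l) ^ (-(p - 1)) * y ^ (-(p - 1))) * (N₂ * z ^ (1 - a) * y⁻¹) := by
          gcongr
      _ ≤ (K ^ (p - 1) * m ^ (-(p - 1)) * y ^ (-(p - 1))) * (N₂ * z ^ (-((p - 1) * (a - 1))) * y⁻¹) := by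
          gcongr
      _ = _ := by rw [hy1]; ring
  have T3 : |(phi p v - phi p v') * E'| ≤ 2 * (K * N ^ (p - 1) *
      (m ^ (-(p - 1)) * y ^ (-(1 + (p - 1))) * z ^ (-((p - 1) * (a - 1))))) := by
    rw [abs_mul]
    calc _ ≤ (2 * (N ^ (p - 1) * m ^ (-(p - 1)) * z ^ (-((p - 1) * (a - 1))) * y ^ (-(p - 1)))) * (K * y⁻¹) := by
          gcongr
      _ = _ := by rw [hy1]; ring
  have e : phi p v * E - phi p v' * E' = phi p v * (E - E') + (phi p v - phi p v') * E' := by ring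
  rw [e]
  refine (abs_add_le _ _).trans ?_
  rw [abs_mul p, abs_of_pos (by linarith : 0 < p)]
  have T4 := (abs_add_le (phi p v * (E - E')) ((phi p v - phi p v') * E')).trans (add_le_add T2 T3)
  have T5 := mul_le_mul_of_nonneg_left T4 (by linarith : 0 ≤ p)
  refine (add_le_add T1 T5).trans (le_of_eq ?_)
  ring

/-- qualitative decay from a pointwise bound -/
lemma qual_of_bound {κ γ M : ℝ} {h : ℝ → ℝ → ℝ} (hκ : 0 ≤ κ) (hM : 0 ≤ M)
    (hb : ∀ l s, 0 < s → |h l s| ≤ M * ((1 + |l|) ^ (-κ) * (1 + s) ^ (-γ))) : Qual (κ + γ) h := by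
  intro R
  refine ⟨M * (1 + |R|) ^ κ, by positivity, fun x s hx hs => ?_⟩
  refine (hb _ s hs).trans ?_
  have hxR : |x| ≤ |R| := hx.trans (le_abs_self R)
  have h1 : 1 + s ≤ (1 + |s + x|) * (1 + |R|) := by
    have a1 : s ≤ |s + x| + |R| := by
      have := neg_abs_le x
      have := le_abs_self (s + x)
      linarith
    nlinarith [abs_nonneg (s + x), abs_nonneg R]
  have h2 : (1 + |s + x|) ^ (-κ) ≤ (1 + |R|) ^ κ * (1 + s) ^ (-κ) := by
    have := rpow_anti (by linarith : 0 < 1 + s) h1 hκ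
    rw [Real.mul_rpow (by positivity) (by positivity)] at this
    have hR : (1 + |R|) ^ (-κ) * (1 + |R|) ^ κ = 1 := by
      rw [← Real.rpow_add (by positivity)]; simp
    have hR0 : 0 ≤ (1 + |R|) ^ κ := by positivity
    calc (1 + |s + x|) ^ (-κ) = ((1 + |s + x|) ^ (-κ) * (1 + |R|) ^ (-κ)) * (1 + |R|) ^ κ := by
          rw [mul_assoc, hR, mul_one]
      _ ≤ (1 + s) ^ (-κ) * (1 + |R|) ^ κ := by gcongr
      _ = _ := by ring
  have h3 : (1 + s) ^ (-(κ + γ)) = (1 + s) ^ (-κ) * (1 + s) ^ (-γ) := by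
    rw [← Real.rpow_add (by linarith)]; ring_nf
  rw [h3]
  calc M * ((1 + |s + x|) ^ (-κ) * (1 + s) ^ (-γ))
      ≤ M * (((1 + |R|) ^ κ * (1 + s) ^ (-κ)) * (1 + s) ^ (-γ)) := by gcongr
    _ = _ := by ring

section norms
variable {u v D : ℝ → ℝ → ℝ}

lemma bracket1_nonneg {r t : ℝ} (hr : 0 < r) : 0 ≤ bracket1 u r t := by
  unfold bracket1; positivity

lemma bracket1_le_bracket2 {r t : ℝ} (hr : 0 < r) : bracket1 u r t ≤ bracket2 u r t := by
  unfold bracket1 bracket2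
  have h1 : 0 ≤ |pdr u r t| + |pdt u r t| := by positivity
  have h2 : 0 ≤ r * (|pdr (pdr u) r t| + |pdr (pdt u) r t| + |pdt (pdt u) r t|) := by positivity
  nlinarith

lemma v_le_b1 (R : RegData u v D) {l s : ℝ} (hl : 0 < l) (hs : 0 < s) :
    l * |v l s| ≤ bracket1 u l s := by
  unfold bracket1
  rw [R.pdt_eq l hs]
  have := abs_nonneg (u l s)
  have : 0 ≤ l * |pdr u l s| := by positivity
  nlinarith

lemma v_le_b2 (R : RegData u v D) {l s : ℝ} (hl : 0 < l) (hs : 0 < s) :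
    (1 + l) * |v l s| ≤ bracket2 u l s := by
  unfold bracket2
  have h2 : 0 ≤ l * (|pdr (pdr u) l s| + |pdr (pdt u) l s| + |pdt (pdt u) l s|) := by positivity
  rw [R.pdt_eq l hs]
  have := abs_nonneg (u l s)
  have : 0 ≤ (1 + l) * |pdr u l s| := by positivity
  nlinarith

lemma E_le_b2 (R : RegData u v D) {l s : ℝ} (hl : 0 < l) (hs : 0 < s) :
    |D l s - v l s| ≤ bracket2 u l s := by
  unfold bracket2
  rw [R.pdr_pdt hl.ne' hs, abs_div, abs_of_pos hl]
  have h1 : 0 ≤ (1 + l) * (|pdr u l s| + |pdt u l s|) := by positivity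
  have h3 : 0 ≤ l * |pdr (pdr u) l s| := by positivity
  have h4 : 0 ≤ l * |pdt (pdt u) l s| := by positivity
  have h5 : l * (|D l s - v l s| / l) = |D l s - v l s| := by field_simp
  have := abs_nonneg (u l s)
  nlinarith

lemma X_bound {ν r t : ℝ} (hb : BddAbove (XSet 2 ν u)) (hr : 0 < r) (ht : 0 ≤ t) (hν : 1 ≤ ν) :
    0 ≤ Xnorm 2 ν u ∧ bracket2 u r t ≤ Xnorm 2 ν u * (1 + |r - t|)⁻¹ := by
  have h : bracket2 u r t * (1 + |r - t|) ^ ν ≤ Xnorm 2 ν u :=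
    le_csSup hb ⟨r, t, hr, ht, by simp [bracketS]⟩
  have h0 : 0 ≤ bracket2 u r t := (bracket1_nonneg hr).trans (bracket1_le_bracket2 hr)
  have hy : 1 ≤ 1 + |r - t| := by linarith [abs_nonneg (r - t)]
  have h1 : 1 + |r - t| ≤ (1 + |r - t|) ^ ν := by
    conv_lhs => rw [← Real.rpow_one (1 + |r - t|)]
    exact Real.rpow_le_rpow_of_exponent_le hy hν
  refine ⟨le_trans (by positivity) h, ?_⟩
  rw [← div_eq_mul_inv, le_div_iff₀ (by positivity)]
  exact (mul_le_mul_of_nonneg_left h1 h0).trans h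

lemma Z1_bdd {a : ℝ} (hb : BddAbove (ZSet 2 a u)) : BddAbove (ZSet 1 a u) ∧ Znorm 1 a u ≤ Znorm 2 a u := by
  have key : ∀ x ∈ ZSet 1 a u, x ≤ Znorm 2 a u := by
    rintro x ⟨r, t, hr, ht, rfl⟩
    have h : bracket2 u r t * (1 + r + t) ^ (a - 1) * (1 + |r - t|) ≤ Znorm 2 a u :=
      le_csSup hb ⟨r, t, hr, ht, by simp [bracketS]⟩
    refine le_trans ?_ h
    simp only [bracketS, if_true]
    have := bracket1_le_bracket2 (u := u) (t := t) hr
    gcongr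
  exact ⟨⟨_, key⟩, csSup_le ⟨_, 1, 0, one_pos, le_rfl, rfl⟩ key⟩

lemma Z_conv {a N b r t : ℝ} (hr : 0 < r) (ht : 0 ≤ t)
    (h : b * (1 + r + t) ^ (a - 1) * (1 + |r - t|) ≤ N) :
    b ≤ N * (1 + r + t) ^ (1 - a) * (1 + |r - t|)⁻¹ := by
  have h1 : (1 + r + t) ^ (1 - a) = ((1 + r + t) ^ (a - 1))⁻¹ := by
    rw [← Real.rpow_neg (by positivity)]; ring_nf
  rw [h1, ← div_eq_mul_inv, ← div_eq_mul_inv, le_div_iff₀ (by positivity), le_div_iff₀ (by positivity)]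
  linarith

lemma Z1_bound {a r t : ℝ} (hb : BddAbove (ZSet 1 a u)) (hr : 0 < r) (ht : 0 ≤ t) :
    0 ≤ Znorm 1 a u ∧ bracket1 u r t ≤ Znorm 1 a u * (1 + r + t) ^ (1 - a) * (1 + |r - t|)⁻¹ := by
  have h : bracket1 u r t * (1 + r + t) ^ (a - 1) * (1 + |r - t|) ≤ Znorm 1 a u :=
    le_csSup hb ⟨r, t, hr, ht, by simp [bracketS]⟩
  have h0 : 0 ≤ bracket1 u r t := bracket1_nonneg hr
  exact ⟨le_trans (by positivity) h, Z_conv hr ht h⟩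

lemma Z2_bound {a r t : ℝ} (hb : BddAbove (ZSet 2 a u)) (hr : 0 < r) (ht : 0 ≤ t) :
    bracket2 u r t ≤ Znorm 2 a u * (1 + r + t) ^ (1 - a) * (1 + |r - t|)⁻¹ := by
  have h : bracket2 u r t * (1 + r + t) ^ (a - 1) * (1 + |r - t|) ≤ Znorm 2 a u :=
    le_csSup hb ⟨r, t, hr, ht, by simp [bracketS]⟩
  exact Z_conv hr ht h

end norms

lemma main_est {p a K A₁ A₂ ν : ℝ} {u u' : ℝ → ℝ → ℝ} (hp : 1 < p) (hp2 : p < 2)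
    (ha : 1 / (p - 1) < a) (hν : 1 ≤ ν)
    (hu : memXnu 2 ν u) (hu' : memXnu 2 ν u') (hd : memZnu 2 a (u - u'))
    (hK : Xnorm 2 ν u + Xnorm 2 ν u' ≤ K)
    (hA₁ : p * K ^ (p - 1) * Znorm 1 a (u - u') ≤ A₁)
    (hA₂ : 2 * p * (K ^ (p - 1) * Znorm 2 a (u - u') + K * Znorm 1 a (u - u') ^ (p - 1)) ≤ A₂)
    (hA : A₁ ≤ A₂) {r t : ℝ} (hr : 0 < r) (ht : 0 ≤ t) :
    bracket1 (Rop (NLt p u - NLt p u')) r t ≤ FC (p - 1) ((p - 1) * (a - 1)) * A₁ * Th ((p - 1) * a) r t ∧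
    bracket2 (Rop (NLt p u - NLt p u')) r t ≤ FC (p - 1) ((p - 1) * (a - 1)) * A₂ * Th ((p - 1) * a) r t := by
  have hk : 0 < p - 1 := by linarith
  have hka : 1 < (p - 1) * a := by
    rw [div_lt_iff₀ hk] at ha; linarith
  have ha1 : 1 < a := by nlinarith
  have he : (p - 1) * a = (p - 1) + (p - 1) * (a - 1) := by ring
  obtain ⟨v, D, R⟩ := exists_regData hu.1
  obtain ⟨v', D', R'⟩ := exists_regData hu'.1
  have Rs := R.sub R'
  obtain ⟨hZ1, hN12⟩ := Z1_bdd hd.2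
  set N₁ := Znorm 1 a (u - u') with hN₁
  set N₂ := Znorm 2 a (u - u') with hN₂
  have hN₁0 : 0 ≤ N₁ := (Z1_bound hZ1 one_pos le_rfl).1
  have hN₂0 : 0 ≤ N₂ := hN₁0.trans hN12
  have hX0 : 0 ≤ Xnorm 2 ν u := (X_bound hu.2 one_pos (le_refl (0:ℝ)) hν).1
  have hX0' : 0 ≤ Xnorm 2 ν u' := (X_bound hu'.2 one_pos (le_refl (0:ℝ)) hν).1
  have hK0 : 0 ≤ K := by linarith
  -- pointwise bounds
  have bX : ∀ l s : ℝ, 0 < l → 0 < s → bracket2 u l s ≤ K * (1 + |l - s|)⁻¹ := by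
    intro l s hl hs
    refine (X_bound hu.2 hl hs.le hν).2.trans ?_
    gcongr; linarith
  have bX' : ∀ l s : ℝ, 0 < l → 0 < s → bracket2 u' l s ≤ K * (1 + |l - s|)⁻¹ := by
    intro l s hl hs
    refine (X_bound hu'.2 hl hs.le hν).2.trans ?_
    gcongr; linarith
  have divl : ∀ m b c : ℝ, 0 < m → m * b ≤ c → b ≤ c * m⁻¹ := by
    intro m b c hm h
    rw [← div_eq_mul_inv, le_div_iff₀ hm]; linarith
  have bv : ∀ l s : ℝ, 0 < l → 0 < s → |v l s| ≤ K * (1 + l)⁻¹ * (1 + |l - s|)⁻¹ := by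
    intro l s hl hs
    refine (divl _ _ _ (by linarith) ((v_le_b2 R hl hs).trans (bX l s hl hs))).trans (le_of_eq (by ring))
  have bv' : ∀ l s : ℝ, 0 < l → 0 < s → |v' l s| ≤ K * (1 + l)⁻¹ * (1 + |l - s|)⁻¹ := by
    intro l s hl hs
    refine (divl _ _ _ (by linarith) ((v_le_b2 R' hl hs).trans (bX' l s hl hs))).trans (le_of_eq (by ring))
  have bE' : ∀ l s : ℝ, 0 < l → 0 < s → |D' l s - v' l s| ≤ K * (1 + |l - s|)⁻¹ :=
    fun l s hl hs => (E_le_b2 R' hl hs).trans (bX' l s hl hs)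
  have bδ1 : ∀ l s : ℝ, 0 < l → 0 < s →
      |v l s - v' l s| ≤ N₁ * l⁻¹ * (1 + l + s) ^ (1 - a) * (1 + |l - s|)⁻¹ := by
    intro l s hl hs
    refine (divl _ _ _ hl ((v_le_b1 Rs hl hs).trans (Z1_bound hZ1 hl hs.le).2)).trans (le_of_eq (by ring))
  have bδ2 : ∀ l s : ℝ, 0 < l → 0 < s →
      |v l s - v' l s| ≤ N₂ * (1 + l)⁻¹ * (1 + l + s) ^ (1 - a) * (1 + |l - s|)⁻¹ := by
    intro l s hl hs
    refine (divl _ _ _ (by linarith) ((v_le_b2 Rs hl hs).trans (Z2_bound hd.2 hl hs.le))).trans (le_of_eq (by ring))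
  have bE : ∀ l s : ℝ, 0 < l → 0 < s →
      |(D l s - v l s) - (D' l s - v' l s)| ≤ N₂ * (1 + l + s) ^ (1 - a) * (1 + |l - s|)⁻¹ := by
    intro l s hl hs
    have h := (E_le_b2 Rs hl hs).trans (Z2_bound hd.2 hl hs.le)
    have e : (D - D') l s - (v - v') l s = (D l s - v l s) - (D' l s - v' l s) := by
      simp only [Pi.sub_apply]; ring
    rwa [e] at h
  set H : ℝ → ℝ → ℝ := fun l s => l * (|v l s| ^ p - |v' l s| ^ p) with hH
  set H' : ℝ → ℝ → ℝ := fun l s => (|v l s| ^ p - |v' l s| ^ p) +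
    p * (phi p (v l s) * (D l s - v l s) - phi p (v' l s) * (D' l s - v' l s)) with hH'
  have cabs : Continuous (fun x : ℝ => |x| ^ p) :=
    Continuous.rpow_const continuous_abs fun x => Or.inr (by linarith)
  have cv : Continuous (fun z : ℝ × ℝ => v z.1 z.2) := R.vc
  have cv' : Continuous (fun z : ℝ × ℝ => v' z.1 z.2) := R'.vc
  have cD : Continuous (fun z : ℝ × ℝ => D z.1 z.2) := R.Dc
  have cD' : Continuous (fun z : ℝ × ℝ => D' z.1 z.2) := R'.Dc
  have cF : Continuous (fun z : ℝ × ℝ => |v z.1 z.2| ^ p - |v' z.1 z.2| ^ p) :=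
    (cabs.comp cv).sub (cabs.comp cv')
  have hHc : Continuous (Function.uncurry H) := continuous_fst.mul cF
  have hH'c : Continuous (Function.uncurry H') := by
    have c1 := (phi_cont hp hp2).comp cv
    have c2 := (phi_cont hp hp2).comp cv'
    exact cF.add (continuous_const.mul ((c1.mul (cD.sub cv)).sub (c2.mul (cD'.sub cv'))))
  have hder : ∀ l s, HasDerivAt (fun l => H l s) (H' l s) l := by
    intro l s
    rcases eq_or_ne l 0 with h0 | h0
    · subst h0
      have c : Continuous (fun l : ℝ => |v l s| ^ p - |v' l s| ^ p) :=
        cF.comp (by fun_prop : Continuous fun l : ℝ => (l, s))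
      have := hasDerivAt_mul_self_zero c.continuousAt
      convert! this using 1
      simp [hH', R.D_zero, R'.D_zero]
    · have d1 := (hasDerivAt_absp hp (v l s)).comp l (R.vl h0 s)
      have d2 := (hasDerivAt_absp hp (v' l s)).comp l (R'.vl h0 s)
      have := (hasDerivAt_id l).mul (d1.sub d2)
      convert! this using 1
      simp only [hH', id, Pi.sub_apply, Function.comp]
      field_simp
  have hodd : ∀ l s, H (-l) s = - H l s := by
    intro l s
    simp only [hH, R.ev, R'.ev]; ring
  have hev : ∀ l s, H' |l| s = H' l s := by
    intro l s
    rcases abs_choice l with h | h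
    · rw [h]
    · rw [h]; simp only [hH', R.ev, R'.ev, R.D_even, R'.D_even]
  have hoddabs : ∀ l s, |H l s| = |H |l| s| := by
    intro l s
    rcases abs_choice l with h | h
    · rw [h]
    · rw [h, hodd, abs_neg]
  have y1 : ∀ l s : ℝ, 1 ≤ 1 + |l - s| := fun l s => by linarith [abs_nonneg (l - s)]
  have Hb : ∀ l s, l ≠ 0 → 0 < s → |H l s| ≤ p * K ^ (p - 1) * N₁ *
      ((1 + |l|) ^ (-(p - 1)) * (1 + |(|l| - s)|) ^ (-(1 + (p - 1))) * (1 + |l| + s) ^ (-((p - 1) * (a - 1)))) := by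
    intro l s hl hs
    have hl' : 0 < |l| := abs_pos.2 hl
    rw [hoddabs]
    exact ptw_H hp hp2 ha1 hK0 hN₁0 hl' (y1 _ _) (by linarith) (bv _ _ hl' hs) (bv' _ _ hl' hs) (bδ1 _ _ hl' hs)
  have H'b : ∀ l s, l ≠ 0 → 0 < s → |H' l s| ≤ 2 * p * (K ^ (p - 1) * N₂ + K * N₁ ^ (p - 1)) *
      Wt (p - 1) ((p - 1) * (a - 1)) |l| s := by
    intro l s hl hs
    have hl' : 0 < |l| := abs_pos.2 hl
    rw [← hev]
    exact ptw_H' hp hp2 ha1 hK0 hN₁0 hN₂0 hl' (by linarith) hl' (y1 _ _) (by linarith)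
      (bv _ _ hl' hs) (bv' _ _ hl' hs) (bE' _ _ hl' hs) (bδ1 _ _ hl' hs) (bδ2 _ _ hl' hs) (bE _ _ hl' hs)
  have H'q : ∀ l s, l ≠ 0 → 0 < s → |H' l s| ≤ 2 * p * (K ^ (p - 1) * N₂ + K * N₂ ^ (p - 1)) *
      ((1 + |l|) ^ (-(p - 1)) * (1 + |(|l| - s)|) ^ (-(1 + (p - 1))) * (1 + |l| + s) ^ (-((p - 1) * (a - 1)))) := by
    intro l s hl hs
    have hl' : 0 < |l| := abs_pos.2 hl
    rw [← hev]
    exact ptw_H' hp hp2 ha1 hK0 hN₂0 hN₂0 (by linarith) le_rfl hl' (y1 _ _) (by linarith)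
      (bv _ _ hl' hs) (bv' _ _ hl' hs) (bE' _ _ hl' hs) (bδ2 _ _ hl' hs) (bδ2 _ _ hl' hs) (bE _ _ hl' hs)
  have hγ : 0 < (p - 1) * (a - 1) := mul_pos hk (by linarith)
  have wle : ∀ l s : ℝ, 0 < s → (1 + |l|) ^ (-(p - 1)) * (1 + |(|l| - s)|) ^ (-(1 + (p - 1))) * (1 + |l| + s) ^ (-((p - 1) * (a - 1)))
      ≤ (1 + |l|) ^ (-(p - 1)) * (1 + s) ^ (-((p - 1) * (a - 1))) := by
    intro l s hs
    have e1 : (1 + |(|l| - s)|) ^ (-(1 + (p - 1))) ≤ 1 :=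
      Real.rpow_le_one_of_one_le_of_nonpos (y1 _ _) (by linarith)
    have e2 : (1 + |l| + s) ^ (-((p - 1) * (a - 1))) ≤ (1 + s) ^ (-((p - 1) * (a - 1))) :=
      rpow_anti (by linarith) (by linarith [abs_nonneg l]) hγ.le
    calc _ ≤ (1 + |l|) ^ (-(p - 1)) * 1 * (1 + s) ^ (-((p - 1) * (a - 1))) := by gcongr
      _ = _ := by ring
  have qgen : ∀ (h : ℝ → ℝ → ℝ) (M : ℝ), 0 ≤ M → Continuous (Function.uncurry h) →
      (∀ l s, l ≠ 0 → 0 < s → |h l s| ≤ M *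
      ((1 + |l|) ^ (-(p - 1)) * (1 + |(|l| - s)|) ^ (-(1 + (p - 1))) * (1 + |l| + s) ^ (-((p - 1) * (a - 1))))) →
      Qual ((p - 1) + (p - 1) * (a - 1)) h := by
    intro h M hM hc hb
    refine qual_of_bound hk.le hM fun l s hs => ?_
    have cl : IsClosed {l : ℝ | |h l s| ≤ M * ((1 + |l|) ^ (-(p - 1)) * (1 + s) ^ (-((p - 1) * (a - 1))))} := by
      refine isClosed_le ?_ ?_
      · exact (hc.comp (by fun_prop : Continuous fun l : ℝ => (l, s))).abs
      · refine continuous_const.mul (Continuous.mul ?_ continuous_const)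
        exact Continuous.rpow_const (by fun_prop) fun x => Or.inl (by positivity)
    have sub : ({0}ᶜ : Set ℝ) ⊆ {l : ℝ | |h l s| ≤ M * ((1 + |l|) ^ (-(p - 1)) * (1 + s) ^ (-((p - 1) * (a - 1))))} := by
      intro x hx
      exact (hb x s hx hs).trans (mul_le_mul_of_nonneg_left (wle x s hs) hM)
    have := closure_minimal sub cl
    rw [(dense_compl_singleton (0:ℝ)).closure_eq] at this
    exact this trivial
  have hp0 : 0 < p := by linarith
  have hq : Qual ((p - 1) + (p - 1) * (a - 1)) H := qgen H _ (by positivity) hHc Hb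
  have hq' : Qual ((p - 1) + (p - 1) * (a - 1)) H' := qgen H' _ (by positivity) hH'c H'q
  have hw : ∀ r t, 0 ≤ t → Rop (NLt p u - NLt p u') r t = 1 / (2 * r) * Iint H r t := by
    intro r t ht
    unfold Rop Iint
    congr 1
    refine setIntegral_congr_fun measurableSet_Ioi fun s hs => ?_
    have hs0 : 0 < s := lt_of_le_of_lt ht hs
    refine intervalIntegral.integral_congr fun l _ => ?_
    simp only [Pi.sub_apply, NLt, hH, R.pdt_eq l hs0, R'.pdt_eq l hs0]
  have hA₁0 : 0 ≤ A₁ := le_trans (by positivity) hA₁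
  rw [he]
  refine core hk (by linarith) hγ (by linarith) hA₁0 hA hHc hH'c hder hodd hq hq' ?_ ?_ hw hr ht
  · intro l s hl hs
    refine (Hb l s hl hs).trans ?_
    gcongr
  · intro l s hl hs
    refine (H'b l s hl hs).trans ?_
    have : 0 ≤ Wt (p - 1) ((p - 1) * (a - 1)) |l| s := by
      unfold Wt; positivity
    gcongr

lemma Z_final {e A : ℝ} {w : ℝ → ℝ → ℝ} (n : ℕ)
    (h : ∀ r t : ℝ, 0 < r → 0 ≤ t → bracketS n w r t ≤ A * Th e r t) :
    BddAbove (ZSet n e w) ∧ Znorm n e w ≤ A := by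
  have key : ∀ x ∈ ZSet n e w, x ≤ A := by
    rintro x ⟨r, t, hr, ht, rfl⟩
    have hb := h r t hr ht
    have h1 : (1 + r + t) ^ (1 - e) * (1 + r + t) ^ (e - 1) = 1 := by
      rw [← Real.rpow_add (by positivity)]; simp
    have h2 : (1 + |r - t|)⁻¹ * (1 + |r - t|) = 1 := inv_mul_cancel₀ (by positivity)
    calc bracketS n w r t * (1 + r + t) ^ (e - 1) * (1 + |r - t|)
        ≤ (A * Th e r t) * (1 + r + t) ^ (e - 1) * (1 + |r - t|) := by gcongr
      _ = A * ((1 + r + t) ^ (1 - e) * (1 + r + t) ^ (e - 1)) * ((1 + |r - t|)⁻¹ * (1 + |r - t|)) := by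
          unfold Th; ring
      _ = A := by rw [h1, h2]; ring
  exact ⟨⟨_, key⟩, csSup_le ⟨_, 1, 0, one_pos, le_rfl, rfl⟩ key⟩

/-- **Lemma 4.7, estimates (4.26)/(4.27).** Under the assumptions of Theorem 2.4:
if `u₂, u₂^* ∈ X²(κ₂)`, `u₂ - u₂^* ∈ Z²(a_{ℓ+1})` and
`‖u₂‖_{X²(κ₂)} + ‖u₂^*‖_{X²(κ₂)} ≤ C ε` with `0 < ε ≤ 1`, then, with
`G(v,v^*) = |∂_t v|^p - |∂_t v^*|^p`,
`‖R(G(u₂,u₂^*))‖_{Z¹(κ₁ a_{ℓ+1})} ≤ C' ε^{p-1} ‖u₂ - u₂^*‖_{Z¹(a_{ℓ+1})}` and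
`‖R(G(u₂,u₂^*))‖_{Z²(κ₁ a_{ℓ+1})} ≤ C' ε^{p-1} d₂(u₂, u₂^*)`. -/
theorem stmt16 (p q : ℝ) (hp1 : 1 < p) (hp2 : p < 2) (hpq : p ≤ q)
    (hcond : (p - 1) ^ 2 * (q - 1) > 1) (ℓ : ℕ)
    (hl1 : 1 / (p - 1) < aseq (p - 1) (q * (p - 1) - 1) (ℓ + 1))
    (hl2 : aseq (p - 1) (q * (p - 1) - 1) ℓ ≤ 1 / (p - 1))
    (C : ℝ) (hC : 0 < C) :
    ∃ C' > 0, ∀ ε : ℝ, 0 < ε → ε ≤ 1 →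
      ∀ u₂ u₂' : ℝ → ℝ → ℝ,
        memXnu 2 (q * (p - 1) - 1) u₂ → memXnu 2 (q * (p - 1) - 1) u₂' →
        memZnu 2 (aseq (p - 1) (q * (p - 1) - 1) (ℓ + 1)) (u₂ - u₂') →
        Xnorm 2 (q * (p - 1) - 1) u₂ + Xnorm 2 (q * (p - 1) - 1) u₂' ≤ C * ε →
        (BddAbove (ZSet 1 ((p - 1) * aseq (p - 1) (q * (p - 1) - 1) (ℓ + 1))
            (Rop (NLt p u₂ - NLt p u₂'))) ∧
          Znorm 1 ((p - 1) * aseq (p - 1) (q * (p - 1) - 1) (ℓ + 1))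
            (Rop (NLt p u₂ - NLt p u₂')) ≤
            C' * ε ^ (p - 1) *
              Znorm 1 (aseq (p - 1) (q * (p - 1) - 1) (ℓ + 1)) (u₂ - u₂')) ∧
        (BddAbove (ZSet 2 ((p - 1) * aseq (p - 1) (q * (p - 1) - 1) (ℓ + 1))
            (Rop (NLt p u₂ - NLt p u₂'))) ∧
          Znorm 2 ((p - 1) * aseq (p - 1) (q * (p - 1) - 1) (ℓ + 1))
            (Rop (NLt p u₂ - NLt p u₂')) ≤
            C' * ε ^ (p - 1) *
              (Znorm 2 (aseq (p - 1) (q * (p - 1) - 1) (ℓ + 1)) (u₂ - u₂') +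
                Znorm 1 (aseq (p - 1) (q * (p - 1) - 1) (ℓ + 1)) (u₂ - u₂') ^
                  (p - 1))) := by
  have hk : 0 < p - 1 := by linarith
  have hk1 : p - 1 < 1 := by linarith
  have hp0 : 0 < p := by linarith
  have hν : 1 ≤ q * (p - 1) - 1 := by
    have h1 : 1 < (p - 1) * ((p - 1) * (q - 1)) := by nlinarith
    have h2 : 0 < (p - 1) * (q - 1) := by
      by_contra h
      push Not at h
      nlinarith
    nlinarith [sq_nonneg (p - 2)]
  generalize aseq (p - 1) (q * (p - 1) - 1) (ℓ + 1) = a at *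
  generalize q * (p - 1) - 1 = ν at *
  have hFC := (FC_pos (γ := (p - 1) * (a - 1)) hk1).1
  refine ⟨FC (p - 1) ((p - 1) * (a - 1)) * (2 * p * (C ^ (p - 1) + C)), by positivity, ?_⟩
  intro ε hε hε1 u₂ u₂' hu hu' hd hK
  have hZ1 := Z1_bdd hd.2
  have hN₁0 : 0 ≤ Znorm 1 a (u₂ - u₂') := (Z1_bound hZ1.1 one_pos le_rfl).1
  have hN₂0 := hN₁0.trans hZ1.2
  have hεk : ε ≤ ε ^ (p - 1) := by
    conv_lhs => rw [← Real.rpow_one ε]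
    exact Real.rpow_le_rpow_of_exponent_ge hε hε1 hk1.le
  have hCk : (C * ε) ^ (p - 1) = C ^ (p - 1) * ε ^ (p - 1) := Real.mul_rpow hC.le hε.le
  have hNk : 0 ≤ Znorm 1 a (u₂ - u₂') ^ (p - 1) := by positivity
  have hCk0 : 0 < C ^ (p - 1) := by positivity
  have hεk0 : 0 < ε ^ (p - 1) := by positivity
  have hA₁ : p * (C * ε) ^ (p - 1) * Znorm 1 a (u₂ - u₂') ≤
      2 * p * (C ^ (p - 1) + C) * ε ^ (p - 1) * Znorm 1 a (u₂ - u₂') := by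
    rw [hCk]
    refine mul_le_mul_of_nonneg_right ?_ hN₁0
    have : C ^ (p - 1) ≤ 2 * (C ^ (p - 1) + C) := by linarith
    calc p * (C ^ (p - 1) * ε ^ (p - 1)) ≤ p * (2 * (C ^ (p - 1) + C) * ε ^ (p - 1)) := by gcongr
      _ = _ := by ring
  have hA₂ : 2 * p * ((C * ε) ^ (p - 1) * Znorm 2 a (u₂ - u₂') + (C * ε) * Znorm 1 a (u₂ - u₂') ^ (p - 1)) ≤
      2 * p * (C ^ (p - 1) + C) * ε ^ (p - 1) *
        (Znorm 2 a (u₂ - u₂') + Znorm 1 a (u₂ - u₂') ^ (p - 1)) := by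
    rw [hCk]
    calc 2 * p * (C ^ (p - 1) * ε ^ (p - 1) * Znorm 2 a (u₂ - u₂') + (C * ε) * Znorm 1 a (u₂ - u₂') ^ (p - 1))
        ≤ 2 * p * ((C ^ (p - 1) + C) * ε ^ (p - 1) * Znorm 2 a (u₂ - u₂') +
          ((C ^ (p - 1) + C) * ε ^ (p - 1)) * Znorm 1 a (u₂ - u₂') ^ (p - 1)) := by
          gcongr
          · linarith
          · linarith
      _ = _ := by ring
  have hA : 2 * p * (C ^ (p - 1) + C) * ε ^ (p - 1) * Znorm 1 a (u₂ - u₂') ≤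
      2 * p * (C ^ (p - 1) + C) * ε ^ (p - 1) *
        (Znorm 2 a (u₂ - u₂') + Znorm 1 a (u₂ - u₂') ^ (p - 1)) := by
    gcongr
    linarith [hZ1.2]
  have key := fun (r t : ℝ) (hr : 0 < r) (ht : 0 ≤ t) =>
    main_est hp1 hp2 hl1 hν hu hu' hd hK hA₁ hA₂ hA hr ht
  constructor
  · have := Z_final 1 (w := Rop (NLt p u₂ - NLt p u₂')) (e := (p - 1) * a) fun r t hr ht => by
      simpa [bracketS] using (key r t hr ht).1
    refine ⟨this.1, this.2.trans (le_of_eq (by ring))⟩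
  · have := Z_final 2 (w := Rop (NLt p u₂ - NLt p u₂')) (e := (p - 1) * a) fun r t hr ht => by
      simpa [bracketS] using (key r t hr ht).2
    refine ⟨this.1, this.2.trans (le_of_eq (by ring))⟩
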